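/- arXiv:0911.2960 — 2 statements merged into one kernel-verified Lean document; each statement's English description precedes it below -/
import Mathlib

section
/- Fix an integer k ≥ 3 and N ≥ 1. The number of k-noncrossing partitions of [N] equals the number of P_{W_{k-1}}-walks of length 2N that start at δ = (k−2, k−3, …, 1, 0) and end at δ. -/
open Finset

/-- Lattice points in `ℤ^(k-1)`; coordinate `i : Fin (k-1)` represents `ν_{i+1}`. -/
abbrev Pt (k : ℕ) := Fin (k - 1) → ℤ

/-- The starting point `δ = (k-2, k-3, …, 1, 0)`. -/
def delta (k : ℕ) : Pt k := fun i => (k : ℤ) - 2 - (i : ℤ)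

/-- Membership in `Q_{k-1}`: all coordinates nonnegative. -/
def inQ {k : ℕ} (v : Pt k) : Prop := ∀ i, 0 ≤ v i

/-- Membership in `W_{k-1}`: `ν_1 > ν_2 > ⋯ > ν_{k-1} ≥ 0`. -/
def inW {k : ℕ} (v : Pt k) : Prop := StrictAnti v ∧ ∀ i, 0 ≤ v i

/-- `eVec k i` is `e_i`: `e_0 = 0` and for `1 ≤ i ≤ k-1`, `e_i` is the `i`-th
standard basis vector of `ℤ^(k-1)`. -/
def eVec (k : ℕ) (i : Fin k) : Pt k := fun j => if (j : ℕ) + 1 = (i : ℕ) then 1 else 0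

/-- The vector `e_1`. -/
def eOne (k : ℕ) : Pt k := fun j => if (j : ℕ) = 0 then 1 else 0

/-- A step in `{+e_i : 0 ≤ i ≤ k-1}`. -/
def plusStep {k : ℕ} (d : Pt k) : Prop := ∃ i : Fin k, d = eVec k i

/-- A step in `{-e_i : 0 ≤ i ≤ k-1}`. -/
def minusStep {k : ℕ} (d : Pt k) : Prop := ∃ i : Fin k, d = -eVec k i

/-- A `𝒫_D`-walk of length `ℓ`: starts at `δ`, stays in `D`, odd steps are `-e_i`,
even steps are `+e_i`. -/
def IsPWalk {k : ℕ} (D : Pt k → Prop) (ℓ : ℕ) (v : Fin (ℓ + 1) → Pt k) : Prop :=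
  v ⟨0, Nat.succ_pos ℓ⟩ = delta k ∧ (∀ t, D (v t)) ∧
    ∀ t : ℕ, ∀ h : t + 1 < ℓ + 1,
      (Odd (t + 1) → minusStep (v ⟨t + 1, h⟩ - v ⟨t, by omega⟩)) ∧
      (Even (t + 1) → plusStep (v ⟨t + 1, h⟩ - v ⟨t, by omega⟩))

/-- A `ℬ_D`-walk of length `ℓ`: starts at `δ`, stays in `D`, odd steps are `+e_i`,
even steps are `-e_i`. -/
def IsBWalk {k : ℕ} (D : Pt k → Prop) (ℓ : ℕ) (v : Fin (ℓ + 1) → Pt k) : Prop :=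
  v ⟨0, Nat.succ_pos ℓ⟩ = delta k ∧ (∀ t, D (v t)) ∧
    ∀ t : ℕ, ∀ h : t + 1 < ℓ + 1,
      (Odd (t + 1) → plusStep (v ⟨t + 1, h⟩ - v ⟨t, by omega⟩)) ∧
      (Even (t + 1) → minusStep (v ⟨t + 1, h⟩ - v ⟨t, by omega⟩))

/-- A walk is loop-free if no odd/even step pair `(+e_1, -e_1)` occurs. -/
def LoopFree {k ℓ : ℕ} (v : Fin (ℓ + 1) → Pt k) : Prop :=
  ∀ q : ℕ, 1 ≤ q → ∀ h : 2 * q < ℓ + 1,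
    ¬ (v ⟨2 * q - 1, by omega⟩ - v ⟨2 * q - 2, by omega⟩ = eOne k ∧
       v ⟨2 * q, h⟩ - v ⟨2 * q - 1, by omega⟩ = -eOne k)

/-- `a^ν_{k,ℓ}`: the number of `𝒫_{Q_{k-1}}`-walks of length `ℓ` ending at `ν`. -/
noncomputable def aCount (k ℓ : ℕ) (ν : Pt k) : ℕ :=
  Nat.card {v : Fin (ℓ + 1) → Pt k //
    IsPWalk (inQ (k := k)) ℓ v ∧ v (Fin.last ℓ) = ν}

/-- `ω^ν_{k,ℓ}`: the number of `𝒫_{W_{k-1}}`-walks of length `ℓ` ending at `ν`. -/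
noncomputable def omegaCount (k ℓ : ℕ) (ν : Pt k) : ℕ :=
  Nat.card {v : Fin (ℓ + 1) → Pt k //
    IsPWalk (inW (k := k)) ℓ v ∧ v (Fin.last ℓ) = ν}

/-- `σ^ν_{k,ℓ}`: the number of `ℬ_{W_{k-1}}`-walks of length `ℓ` ending at `ν`. -/
noncomputable def sigmaCount (k ℓ : ℕ) (ν : Pt k) : ℕ :=
  Nat.card {v : Fin (ℓ + 1) → Pt k //
    IsBWalk (inW (k := k)) ℓ v ∧ v (Fin.last ℓ) = ν}

/-- `σ^{ν;*}_{k,ℓ}`: the number of loop-free `ℬ_{W_{k-1}}`-walks of length `ℓ`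
ending at `ν`. -/
noncomputable def sigmaStarCount (k ℓ : ℕ) (ν : Pt k) : ℕ :=
  Nat.card {v : Fin (ℓ + 1) → Pt k //
    IsBWalk (inW (k := k)) ℓ v ∧ LoopFree v ∧ v (Fin.last ℓ) = ν}

/-- `(a,b)` is an arc of the standard representation of the partition `P`:
`a < b`, `a` and `b` lie in a common block `B`, and no element of `B` lies
strictly between them. -/
def IsArc {N : ℕ} (P : Finpartition (Finset.univ : Finset (Fin N))) (a b : Fin N) : Prop :=
  a < b ∧ ∃ B ∈ P.parts, a ∈ B ∧ b ∈ B ∧ ∀ c ∈ B, ¬(a < c ∧ c < b)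

/-- The partition `P` has a `k`-crossing: arcs `(i₁,j₁),…,(i_k,j_k)` with
`i₁ < ⋯ < i_k < j₁ < ⋯ < j_k`. -/
def PartitionHasKCrossing {N : ℕ} (k : ℕ)
    (P : Finpartition (Finset.univ : Finset (Fin N))) : Prop :=
  ∃ ii jj : Fin k → Fin N, (∀ m, IsArc P (ii m) (jj m)) ∧
    StrictMono ii ∧ StrictMono jj ∧ ∀ m m', ii m < jj m'

/-- The partition `P` is `2`-regular: distinct elements of a common block differ
by at least `2`. -/
def TwoRegular {N : ℕ} (P : Finpartition (Finset.univ : Finset (Fin N))) : Prop :=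
  ∀ B ∈ P.parts, ∀ x ∈ B, ∀ y ∈ B, x ≠ y → 2 ≤ |((x : ℕ) : ℤ) - ((y : ℕ) : ℤ)|

/-- A braid over `[N]`, given by its arc set: arcs `(i,j)` with `i ≤ j` (loops
allowed), each vertex is the smaller endpoint of at most one arc and the larger
endpoint of at most one arc. -/
def IsBraid {N : ℕ} (A : Finset (Fin N × Fin N)) : Prop :=
  (∀ p ∈ A, p.1 ≤ p.2) ∧ (∀ p ∈ A, ∀ q ∈ A, p.1 = q.1 → p = q) ∧
    (∀ p ∈ A, ∀ q ∈ A, p.2 = q.2 → p = q)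

/-- The braid with arc set `A` has a `k`-crossing: arcs `(i₁,j₁),…,(i_k,j_k)`
with `i₁ < ⋯ < i_k ≤ j₁ < ⋯ < j_k`. -/
def BraidHasKCrossing {N : ℕ} (k : ℕ) (A : Finset (Fin N × Fin N)) : Prop :=
  ∃ ii jj : Fin k → Fin N, (∀ m, (ii m, jj m) ∈ A) ∧
    StrictMono ii ∧ StrictMono jj ∧ ∀ m m', ii m ≤ jj m'

/-- A braid is loop-free if it has no arc `(i,i)`. -/
def BraidLoopFree {N : ℕ} (A : Finset (Fin N × Fin N)) : Prop :=
  ∀ p ∈ A, p.1 ≠ p.2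

/-- The inverse local rule: the label entering a cell along one direction, given the label `a`
leaving it along the same direction and the label `b` leaving it along the other one. -/
def unbump (a b : ℕ) : ℕ := if a = b then a - 1 else a

/-- Edge labels of a growth diagram on the staircase of cells `(x, y)` with `x + y + 1 < N`:
`h x y` and `v x y` are the labels entering the cell `(x, y)` in the directions of increasing `x`
and increasing `y` respectively. A label `r ≥ 1` records that the shapes at the endpoints of
the edge differ by a box in row `r`, the label `0` that they agree. -/
structure IsGrowth (N : ℕ) (h v : ℕ → ℕ → ℕ) : Prop where
  left : ∀ y, h 0 y = 0
  top : ∀ x, v x 0 = 0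
  row : ∀ x y, x + y + 1 < N → h x y = unbump (h (x + 1) y) (v x (y + 1))
  col : ∀ x y, x + y + 1 < N → v x y = unbump (v x (y + 1)) (h (x + 1) y)

/-- The cell `(x, y)` is an `r`-point: both labels leaving it are equal to `r`. -/
def IsPt (N : ℕ) (h v : ℕ → ℕ → ℕ) (r x y : ℕ) : Prop :=
  x + y + 1 < N ∧ h (x + 1) y = r ∧ v x (y + 1) = r

/-- The sequences `X`, `Y` list `m` crossing `r`-points, all in a common rectangle. -/
def IsPtChain (N : ℕ) (h v : ℕ → ℕ → ℕ) (r m : ℕ) (X Y : ℕ → ℕ) : Prop :=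
  (∀ s < m, IsPt N h v r (X s) (Y s)) ∧
    (∀ s, s + 1 < m → X s < X (s + 1) ∧ Y (s + 1) < Y s) ∧ X (m - 1) + Y 0 + 1 < N

namespace IsGrowth

variable {N : ℕ} {h v : ℕ → ℕ → ℕ}

theorem swap (G : IsGrowth N h v) : IsGrowth N (fun x y => v y x) (fun x y => h y x) :=
  ⟨G.top, G.left, fun x y hxy => G.col y x (by omega), fun x y hxy => G.row y x (by omega)⟩

theorem row_le (G : IsGrowth N h v) {x y : ℕ} (hxy : x + y + 1 < N) :
    h x y ≤ h (x + 1) y := by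
  have := G.row x y hxy
  unfold unbump at this
  split_ifs at this <;> omega

theorem row_le_add (G : IsGrowth N h v) {x y : ℕ} (n : ℕ) (hxy : x + n + y + 1 ≤ N) :
    h x y ≤ h (x + n) y := by
  induction n with
  | zero => simp
  | succ n ih => exact (ih (by omega)).trans (G.row_le (by omega))

/-- A row label `r` starts at an `r`-point and is constant from there on. -/
theorem exists_row_source (G : IsGrowth N h v) {r : ℕ} (hr : 1 ≤ r) (x y : ℕ)
    (hxy : x + y + 1 ≤ N) (hx : h x y = r) :
    ∃ x' < x, IsPt N h v r x' y ∧ ∀ z, x' < z → z ≤ x → h z y = r := by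
  induction x with
  | zero => have := G.left y; omega
  | succ x ih =>
    by_cases hv : v x (y + 1) = r
    · refine ⟨x, by omega, ⟨by omega, hx, hv⟩, fun z h1 h2 => ?_⟩
      obtain rfl : z = x + 1 := by omega
      exact hx
    · have := G.row x y (by omega)
      rw [unbump, if_neg (by omega)] at this
      obtain ⟨x', h1, h2, h3⟩ := ih (by omega) (by omega)
      refine ⟨x', by omega, h2, fun z hz hz' => ?_⟩
      rcases Nat.lt_or_ge x z with hlt | hge
      · obtain rfl : z = x + 1 := by omega
        exact hx
      · exact h3 z hz hge

theorem exists_col_source (G : IsGrowth N h v) {r : ℕ} (hr : 1 ≤ r) (x y : ℕ)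
    (hxy : x + y + 1 ≤ N) (hx : v x y = r) :
    ∃ y' < y, IsPt N h v r x y' ∧ ∀ z, y' < z → z ≤ y → v x z = r := by
  obtain ⟨y', h1, ⟨h2, h3, h4⟩, h5⟩ := G.swap.exists_row_source hr y x (by omega) hx
  exact ⟨y', h1, ⟨by omega, h4, h3⟩, h5⟩

/-- A nonzero row label lies to the right of a `1`-point. -/
theorem exists_pt_one_of_row (G : IsGrowth N h v) (x y : ℕ) (hxy : x + y + 1 ≤ N)
    (hx : h x y ≠ 0) : ∃ x' < x, IsPt N h v 1 x' y := by
  induction x with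
  | zero => exact absurd (G.left y) hx
  | succ x ih =>
    by_cases h0 : h x y = 0
    · have := G.row x y (by omega)
      refine ⟨x, by omega, by omega, ?_⟩
      unfold unbump at this
      split_ifs at this <;> omega
    · obtain ⟨x', h1, h2⟩ := ih (by omega) h0
      exact ⟨x', by omega, h2⟩

theorem exists_pt_one_of_col (G : IsGrowth N h v) (x y : ℕ) (hxy : x + y + 1 ≤ N)
    (hx : v x y ≠ 0) : ∃ y' < y, IsPt N h v 1 x y' := by
  obtain ⟨y', h1, h2, h3, h4⟩ := G.swap.exists_pt_one_of_row y x (by omega) hx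
  exact ⟨y', h1, by omega, h4, h3⟩

theorem pt_one_row_unique (G : IsGrowth N h v) {x x' y : ℕ} (h1 : IsPt N h v 1 x y)
    (h2 : IsPt N h v 1 x' y) : x = x' := by
  by_contra hne
  wlog hlt : x < x' generalizing x x'
  · exact this h2 h1 (Ne.symm hne) (by omega)
  obtain ⟨n, rfl⟩ : ∃ n, x' = x + 1 + n := ⟨x' - x - 1, by omega⟩
  obtain ⟨ha, hb, hc⟩ := h2
  have := G.row_le_add (x := x + 1) (y := y) n (by omega)
  have := G.row _ _ ha
  rw [hb, hc] at this
  have := h1.2.1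
  simp [unbump] at *
  omega

theorem pt_one_col_unique (G : IsGrowth N h v) {x y y' : ℕ} (h1 : IsPt N h v 1 x y)
    (h2 : IsPt N h v 1 x y') : y = y' :=
  G.swap.pt_one_row_unique (x := y) (x' := y') (y := x) ⟨by have := h1.1; omega, h1.2.2, h1.2.1⟩
    ⟨by have := h2.1; omega, h2.2.2, h2.2.1⟩

/-- If a row ray labelled `r` is not bumped on its way, it keeps its label. -/
theorem row_persist (G : IsGrowth N h v) {r : ℕ} {x y : ℕ} (hx : h (x + 1) y = r) (n : ℕ)
    (hn : x + n + y + 1 < N)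
    (hno : ∀ z, x < z → z ≤ x + n → ¬ IsPt N h v (r + 1) z y) :
    h (x + n + 1) y = r := by
  induction n with
  | zero => exact hx
  | succ n ih =>
    have h1 := ih (by omega) (fun z h1 h2 => hno z h1 (by omega))
    have h2 := hno (x + n + 1) (by omega) (by omega)
    have h3 := G.row (x + n + 1) y (by omega)
    rw [h1, unbump] at h3
    rw [← add_assoc]
    split_ifs at h3 with h4
    · by_contra h5
      exact h2 ⟨by omega, by omega, by omega⟩
    · exact h3.symm

/-- Between two crossing `r`-points there is an `(r + 1)`-point. -/
theorem exists_pt_succ_between (G : IsGrowth N h v) {r x y x' y' : ℕ} (hr : 1 ≤ r)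
    (hp : IsPt N h v r x y) (hq : IsPt N h v r x' y') (hx : x < x') (hy : y' < y)
    (hxy : x' + y + 1 < N) :
    ∃ a b, IsPt N h v (r + 1) a b ∧ x < a ∧ a ≤ x' ∧ y' < b ∧ b ≤ y := by
  by_contra! hcon
  have h1 : ∀ n, x + n ≤ x' → h (x + n + 1) y = r := fun n hn =>
    G.row_persist hp.2.1 n (by omega) fun z h1 h2 h3 =>
      absurd (hcon z y h3 h1 (by omega) hy) (by omega)
  have h2 : v x' (y' + (y - y') + 1) = r :=
    G.swap.row_persist (x := y') (y := x') hq.2.2 (y - y') (by omega) fun z h1 h2 h3 =>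
      absurd (hcon x' z ⟨by have := h3.1; omega, h3.2.2, h3.2.1⟩ hx le_rfl h1) (by omega)
  have h3 := h1 (x' - x) (by omega)
  have h4 := h1 (x' - x - 1) (by omega)
  rw [show x + (x' - x) + 1 = x' + 1 by omega] at h3
  rw [show x + (x' - x - 1) + 1 = x' by omega] at h4
  rw [show y' + (y - y') + 1 = y + 1 by omega] at h2
  have h5 := G.row x' y hxy
  rw [h3, h2, h4] at h5
  simp [unbump] at h5
  omega

/-- Between two crossing `(r + 1)`-points there is an `r`-point. -/
theorem exists_pt_between (G : IsGrowth N h v) {r x y x' y' : ℕ} (hr : 1 ≤ r)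
    (hp : IsPt N h v (r + 1) x y) (hq : IsPt N h v (r + 1) x' y') (hx : x < x') (hy : y' < y) :
    ∃ a b, IsPt N h v r a b ∧ x ≤ a ∧ a < x' ∧ y' ≤ b ∧ b < y := by
  have hp' := G.col x y hp.1
  have hq' := G.row x' y' hq.1
  rw [hp.2.1, hp.2.2] at hp'
  rw [hq.2.1, hq.2.2] at hq'
  simp only [unbump, if_true, Nat.add_sub_cancel] at hp' hq'
  obtain ⟨b, hb, hb1, hb2⟩ := G.exists_col_source hr x y hp.1.le hp'
  obtain ⟨a, ha, ha1, ha2⟩ := G.exists_row_source hr x' y' hq.1.le hq'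
  by_cases h1 : y' ≤ b
  · exact ⟨x, b, hb1, le_rfl, hx, h1, hb⟩
  by_cases h2 : x ≤ a
  · exact ⟨a, y', ha1, h2, ha, le_rfl, hy⟩
  have h3 := G.row x y' (by have := hp.1; omega)
  rw [ha2 x (by omega) (by omega), ha2 (x + 1) (by omega) (by omega),
    hb2 (y' + 1) (by omega) (by omega)] at h3
  simp [unbump] at h3
  omega

theorem exists_chain_succ_label (G : IsGrowth N h v) {r m : ℕ} (hr : 1 ≤ r) (hm : 1 ≤ m)
    {X Y : ℕ → ℕ} (hc : IsPtChain N h v r (m + 1) X Y) :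
    ∃ X' Y', IsPtChain N h v (r + 1) m X' Y' := by
  obtain ⟨h1, h2, h3⟩ := hc
  have hX : ∀ s, s ≤ m → X s ≤ X m := fun s hs =>
    Nat.decreasingInduction (motive := fun s _ => X s ≤ X m)
      (fun s hs ih => ((h2 s (by omega)).1.le).trans ih) le_rfl hs
  have hY : ∀ s, s ≤ m → Y s ≤ Y 0 := fun s hs => by
    induction s with
    | zero => exact le_rfl
    | succ s ih => exact ((h2 s (by omega)).2.le).trans (ih (by omega))
  have key : ∀ s, ∃ a b, s < m → IsPt N h v (r + 1) a b ∧ X s < a ∧ a ≤ X (s + 1) ∧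
      Y (s + 1) < b ∧ b ≤ Y s := fun s => by
    by_cases hs : s < m
    · obtain ⟨a, b, hab⟩ := G.exists_pt_succ_between hr (h1 s (by omega)) (h1 (s + 1) (by omega))
        (h2 s (by omega)).1 (h2 s (by omega)).2 (by
          have := hX (s + 1) hs
          have := hY s hs.le
          simp only [Nat.add_sub_cancel] at h3
          omega)
      exact ⟨a, b, fun _ => hab⟩
    · exact ⟨0, 0, fun h => absurd h hs⟩
  choose X' Y' hXY using key
  refine ⟨X', Y', fun s hs => (hXY s hs).1, fun s hs => ?_, ?_⟩
  · have := hXY s (by omega)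
    have := hXY (s + 1) hs
    omega
  · have h4 := hXY (m - 1) (by omega)
    have h5 := hXY 0 (by omega)
    rw [Nat.sub_add_cancel hm] at h4
    simp only [Nat.add_sub_cancel] at h3
    omega

theorem exists_chain_succ_length (G : IsGrowth N h v) {r m : ℕ} (hr : 1 ≤ r) (hm : 1 ≤ m)
    {X Y : ℕ → ℕ} (hc : IsPtChain N h v (r + 1) m X Y) :
    ∃ X' Y', IsPtChain N h v r (m + 1) X' Y' := by
  obtain ⟨h1, h2, h3⟩ := hc
  have key : ∀ s, ∃ a b, s ≤ m → IsPt N h v r a b ∧ (1 ≤ s → X (s - 1) ≤ a ∧ b < Y (s - 1)) ∧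
      (s < m → a < X s ∧ Y s ≤ b) ∧ (s = 0 → b = Y 0) ∧ (s = m → a = X (m - 1)) := fun s => by
    rcases Nat.eq_zero_or_pos s with rfl | hs
    · have hp := h1 0 (by omega)
      have hq := G.row _ _ hp.1
      rw [hp.2.1, hp.2.2] at hq
      simp only [unbump, if_true, Nat.add_sub_cancel] at hq
      obtain ⟨a, ha, ha1, -⟩ := G.exists_row_source hr _ _ hp.1.le hq
      exact ⟨a, Y 0, fun _ => ⟨ha1, by omega, fun _ => ⟨ha, le_rfl⟩, fun _ => rfl, by omega⟩⟩
    rcases lt_trichotomy s m with hsm | rfl | hsm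
    · obtain ⟨s, rfl⟩ : ∃ t, s = t + 1 := ⟨s - 1, by omega⟩
      obtain ⟨a, b, h4, h5⟩ := G.exists_pt_between hr (h1 s (by omega)) (h1 (s + 1) hsm)
        (h2 s hsm).1 (h2 s hsm).2
      exact ⟨a, b, fun _ => ⟨h4, fun _ => ⟨h5.1, h5.2.2.2⟩, fun _ => ⟨h5.2.1, h5.2.2.1⟩,
        by omega, by omega⟩⟩
    · have hp := h1 (s - 1) (by omega)
      have hq := G.col _ _ hp.1
      rw [hp.2.1, hp.2.2] at hq
      simp only [unbump, if_true, Nat.add_sub_cancel] at hq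
      obtain ⟨b, hb, hb1, -⟩ := G.exists_col_source hr _ _ hp.1.le hq
      exact ⟨X (s - 1), b, fun _ => ⟨hb1, fun _ => ⟨le_rfl, hb⟩, by omega, by omega,
        fun _ => rfl⟩⟩
    · exact ⟨0, 0, fun h => absurd h (by omega)⟩
  choose X' Y' hXY using key
  refine ⟨X', Y', fun s hs => (hXY s (by omega)).1, fun s hs => ?_, ?_⟩
  · obtain ⟨-, -, h5, -⟩ := hXY s (by omega)
    obtain ⟨-, h4, -⟩ := hXY (s + 1) (by omega)
    have h4 := h4 (by omega)
    have h5 := h5 (by omega)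
    simp only [Nat.add_sub_cancel] at h4
    omega
  · have h4 := (hXY m le_rfl).2.2.2.2 rfl
    have h5 := (hXY 0 (by omega)).2.2.2.1 rfl
    simp only [Nat.add_sub_cancel]
    omega

/-- Schensted's theorem for growth diagrams: `m + 1` crossing `1`-points yield an
`(m + 1)`-point. -/
theorem exists_pt_of_chain (G : IsGrowth N h v) (m : ℕ) {r : ℕ} (hr : 1 ≤ r) {X Y : ℕ → ℕ}
    (hc : IsPtChain N h v r (m + 1) X Y) : ∃ x y, IsPt N h v (r + m) x y := by
  induction m generalizing r X Y with
  | zero => exact ⟨_, _, hc.1 0 (by omega)⟩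
  | succ m ih =>
    obtain ⟨X', Y', hc'⟩ := G.exists_chain_succ_label hr (by omega) hc
    obtain ⟨x, y, hp⟩ := ih (by omega) hc'
    exact ⟨x, y, by rwa [show r + (m + 1) = r + 1 + m by omega]⟩

theorem exists_chain_of_chain (G : IsGrowth N h v) (r : ℕ) {m : ℕ} (hm : 1 ≤ m) {X Y : ℕ → ℕ}
    (hc : IsPtChain N h v (r + 1) m X Y) : ∃ X' Y', IsPtChain N h v 1 (m + r) X' Y' := by
  induction r generalizing m X Y with
  | zero => exact ⟨X, Y, hc⟩
  | succ r ih =>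
    obtain ⟨X', Y', hc'⟩ := G.exists_chain_succ_length (by omega) hm hc
    obtain ⟨X'', Y'', hc''⟩ := ih (by omega) hc'
    exact ⟨X'', Y'', by rwa [show m + (r + 1) = m + 1 + r by omega]⟩

theorem exists_chain_of_pt (G : IsGrowth N h v) {r x y : ℕ} (hr : 1 ≤ r)
    (hp : IsPt N h v r x y) : ∃ X Y, IsPtChain N h v 1 r X Y := by
  obtain ⟨r, rfl⟩ : ∃ t, r = t + 1 := ⟨r - 1, by omega⟩
  have hc : IsPtChain N h v (r + 1) 1 (fun _ => x) (fun _ => y) :=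
    ⟨fun _ _ => hp, fun _ _ => by omega, hp.1⟩
  obtain ⟨X, Y, hXY⟩ := G.exists_chain_of_chain r le_rfl hc
  exact ⟨X, Y, by rwa [add_comm]⟩

end IsGrowth

theorem IsPtChain.mono {N : ℕ} {h v : ℕ → ℕ → ℕ} {r m m' : ℕ} {X Y : ℕ → ℕ}
    (hc : IsPtChain N h v r m X Y) (hm : 1 ≤ m') (hmm : m' ≤ m) : IsPtChain N h v r m' X Y := by
  obtain ⟨h1, h2, h3⟩ := hc
  have hX : ∀ s, s ≤ m - 1 → X s ≤ X (m - 1) := fun s hs =>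
    Nat.decreasingInduction (motive := fun s _ => X s ≤ X (m - 1))
      (fun s hs ih => ((h2 s (by omega)).1.le).trans ih) le_rfl hs
  refine ⟨fun s hs => h1 s (by omega), fun s hs => h2 s (by omega), ?_⟩
  have := hX (m' - 1) (by omega)
  omega

namespace IsGrowth

variable {N : ℕ} {h v : ℕ → ℕ → ℕ}

/-- There is no `k`-crossing among the `1`-points iff all labels on the diagonal are
less than `k`. -/
theorem diag_lt_iff (G : IsGrowth N h v) {k : ℕ} (hk : 1 ≤ k) :
    (∀ t < N, h t (N - 1 - t) < k ∧ v t (N - 1 - t) < k) ↔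
      ¬ ∃ X Y, IsPtChain N h v 1 k X Y := by
  constructor
  · rintro hd ⟨X, Y, hc⟩
    obtain ⟨m, rfl⟩ : ∃ m, k = m + 1 := ⟨k - 1, by omega⟩
    obtain ⟨x, y, h1, h2, -⟩ := G.exists_pt_of_chain m le_rfl hc
    have h3 := G.row_le_add (x := x + 1) (y := y) (N - 1 - y - (x + 1)) (by omega)
    have h4 := (hd (N - 1 - y) (by omega)).1
    rw [show x + 1 + (N - 1 - y - (x + 1)) = N - 1 - y by omega] at h3
    rw [show N - 1 - (N - 1 - y) = y by omega] at h4
    omega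
  · intro hno t ht
    constructor
    · by_contra! hge
      obtain ⟨x, -, hp, -⟩ := G.exists_row_source (hk.trans hge) t _ (by omega) rfl
      obtain ⟨X, Y, hc⟩ := G.exists_chain_of_pt (hk.trans hge) hp
      exact hno ⟨X, Y, hc.mono hk hge⟩
    · by_contra! hge
      obtain ⟨x, -, hp, -⟩ := G.exists_col_source (hk.trans hge) t _ (by omega) rfl
      obtain ⟨X, Y, hc⟩ := G.exists_chain_of_pt (hk.trans hge) hp
      exact hno ⟨X, Y, hc.mono hk hge⟩

/-- A growth diagram is determined by its labels on the diagonal. -/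
theorem eq_of_diag (G : IsGrowth N h v) {h' v' : ℕ → ℕ → ℕ} (G' : IsGrowth N h' v')
    (hd : ∀ t < N, h t (N - 1 - t) = h' t (N - 1 - t) ∧ v t (N - 1 - t) = v' t (N - 1 - t))
    (d x y : ℕ) (hxy : x + y + 1 + d = N) : h x y = h' x y ∧ v x y = v' x y := by
  induction d generalizing x y with
  | zero =>
    obtain rfl : y = N - 1 - x := by omega
    exact hd x (by omega)
  | succ d ih =>
    rw [G.row x y (by omega), G'.row x y (by omega), G.col x y (by omega), G'.col x y (by omega),
      (ih (x + 1) y (by omega)).1, (ih x (y + 1) (by omega)).2]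
    exact ⟨rfl, rfl⟩

/-- A growth diagram is determined by its `1`-points. -/
theorem eq_of_pt (G : IsGrowth N h v) {h' v' : ℕ → ℕ → ℕ} (G' : IsGrowth N h' v')
    (hp : ∀ x y, IsPt N h v 1 x y ↔ IsPt N h' v' 1 x y)
    (d x y : ℕ) (hd : x + y = d) (hxy : x + y + 1 ≤ N) : h x y = h' x y ∧ v x y = v' x y := by
  induction d generalizing x y with
  | zero =>
    obtain ⟨rfl, rfl⟩ : x = 0 ∧ y = 0 := by omega
    exact ⟨by rw [G.left, G'.left], by rw [G.top, G'.top]⟩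
  | succ d ih =>
    have aux : ∀ x y, x + y = d → x + y + 1 < N →
        h (x + 1) y = h' (x + 1) y ∧ v x (y + 1) = v' x (y + 1) := fun x y h0 hxy => by
      have h1 := G.row x y hxy
      have h2 := G'.row x y hxy
      have h3 := G.col x y hxy
      have h4 := G'.col x y hxy
      have h5 := ih x y h0 hxy.le
      have h6 := hp x y
      simp only [IsPt, hxy, true_and] at h6
      unfold unbump at *
      split_ifs at * <;> omega
    constructor
    · cases x with
      | zero => rw [G.left, G'.left]
      | succ x => exact (aux x y (by omega) (by omega)).1
    · cases y with
      | zero => rw [G.top, G'.top]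
      | succ y => exact (aux x y (by omega) (by omega)).2

end IsGrowth
theorem exists_growth_of_pts (N : ℕ) (X : ℕ → ℕ → Prop)
    (hrow : ∀ x x' y, X x y → X x' y → x = x') (hcol : ∀ x y y', X x y → X x y' → y = y') :
    ∃ h v, IsGrowth N h v ∧ ∀ x y, x + y + 1 < N → (X x y ↔ IsPt N h v 1 x y) := by
  classical
  induction N with
  | zero =>
    exact ⟨fun _ _ => 0, fun _ _ => 0, ⟨fun _ => rfl, fun _ => rfl, by omega, by omega⟩, by omega⟩
  | succ N ih =>
    obtain ⟨h, v, G, hX⟩ := ih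
    have h0 : ∀ x y, x + y + 1 ≤ N → X x y → h x y = 0 ∧ v x y = 0 := fun x y hxy hXxy => by
      constructor
      · by_contra hne
        obtain ⟨x', hx', hp⟩ := G.exists_pt_one_of_row x y hxy hne
        have := hrow _ _ _ hXxy ((hX x' y hp.1).2 hp)
        omega
      · by_contra hne
        obtain ⟨y', hy', hp⟩ := G.exists_pt_one_of_col x y hxy hne
        have := hcol _ _ _ hXxy ((hX x y' hp.1).2 hp)
        omega
    let f : ℕ → ℕ → Prop → ℕ := fun a b p =>
      if a = b then (if a = 0 then (if p then 1 else 0) else a + 1) else a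
    have hf : ∀ a b p, (p → a = 0 ∧ b = 0) → a = unbump (f a b p) (f b a p) ∧
        b = unbump (f b a p) (f a b p) ∧ (p ↔ f a b p = 1 ∧ f b a p = 1) := fun a b p hp => by
      simp only [f, unbump]
      grind
    let h' : ℕ → ℕ → ℕ := fun x y =>
      if x + y = N then (match x with
        | 0 => 0
        | x + 1 => f (h x y) (v x y) (X x y)) else h x y
    let v' : ℕ → ℕ → ℕ := fun x y =>
      if x + y = N then (match y with
        | 0 => 0
        | y + 1 => f (v x y) (h x y) (X x y)) else v x y
    have hh : ∀ x y, x + y ≠ N → h' x y = h x y := fun x y hxy => if_neg hxy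
    have hv : ∀ x y, x + y ≠ N → v' x y = v x y := fun x y hxy => if_neg hxy
    have hh' : ∀ x y, x + 1 + y = N → h' (x + 1) y = f (h x y) (v x y) (X x y) :=
      fun x y hxy => if_pos hxy
    have hv' : ∀ x y, x + (y + 1) = N → v' x (y + 1) = f (v x y) (h x y) (X x y) :=
      fun x y hxy => if_pos hxy
    refine ⟨h', v', ⟨fun y => ?_, fun x => ?_, fun x y hxy => ?_, fun x y hxy => ?_⟩,
      fun x y hxy => ?_⟩
    · by_cases hy : 0 + y = N
      · exact if_pos hy
      · rw [hh _ _ hy, G.left]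
    · by_cases hx : x + 0 = N
      · exact if_pos hx
      · rw [hv _ _ hx, G.top]
    all_goals by_cases hN : x + 1 + y = N
    · rw [hh' x y hN, hv' x y (by omega), hh x y (by omega)]
      exact (hf _ _ _ (h0 x y (by omega))).1
    · rw [hh _ _ hN, hv _ _ (by omega), hh _ _ (by omega)]
      exact G.row x y (by omega)
    · rw [hh' x y hN, hv' x y (by omega), hv x y (by omega)]
      exact (hf _ _ _ (h0 x y (by omega))).2.1
    · rw [hh _ _ hN, hv _ _ (by omega), hv _ _ (by omega)]
      exact G.col x y (by omega)
    · simp only [IsPt, hxy, true_and, hh' x y hN, hv' x y (by omega)]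
      exact (hf _ _ _ (h0 x y (by omega))).2.2
    · rw [IsPt, hh _ _ hN, hv _ _ (by omega), hX x y (by omega), IsPt]
      simp [hxy, show x + y + 1 < N by omega]

/-- The change of the `r`-th row of a shape along an edge labelled `a`. -/
def boxAt (a r : ℕ) : ℤ := if a = r then 1 else 0

theorem add_boxAt_le {n n' : ℤ} {r a b : ℕ} (hr : 1 ≤ r) (h0 : n' ≤ n)
    (ha : n' + boxAt (unbump a b) (r + 1) ≤ n + boxAt (unbump a b) r)
    (hb : n' + boxAt (unbump b a) (r + 1) ≤ n + boxAt (unbump b a) r) :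
    n' + boxAt (unbump a b) (r + 1) + boxAt b (r + 1) ≤
      n + boxAt (unbump a b) r + boxAt b r := by
  unfold boxAt unbump at *
  split_ifs at * <;> omega

theorem sub_boxAt_le {n n' : ℤ} {r a b : ℕ} (hr : 1 ≤ r) (h0 : n' ≤ n)
    (ha : n' - boxAt a (r + 1) ≤ n - boxAt a r) (hb : n' - boxAt b (r + 1) ≤ n - boxAt b r) :
    n' - boxAt b (r + 1) - boxAt (unbump a b) (r + 1) ≤
      n - boxAt b r - boxAt (unbump a b) r := by
  unfold boxAt unbump at *
  split_ifs at * <;> omega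

theorem sub_boxAt_nonneg {n n' : ℤ} {r a b : ℕ} (hr : 1 ≤ r) (h0 : n' ≤ n)
    (ha : 0 ≤ n - boxAt a r) (hb : 0 ≤ n - boxAt b r) (ha' : 0 ≤ n' - boxAt a (r + 1)) :
    0 ≤ n - boxAt b r - boxAt (unbump a b) r := by
  unfold boxAt unbump at *
  split_ifs at * <;> omega

/-- The length of the `r`-th row of the shape at the corner `(x, y)`. -/
def shapeRow (v : ℕ → ℕ → ℕ) (x y r : ℕ) : ℤ := ∑ x' ∈ range x, boxAt (v x' y) r

theorem shapeRow_succ_left (v : ℕ → ℕ → ℕ) (x y r : ℕ) :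
    shapeRow v (x + 1) y r = shapeRow v x y r + boxAt (v x y) r :=
  Finset.sum_range_succ _ _

theorem shapeRow_nonneg (v : ℕ → ℕ → ℕ) (x y r : ℕ) : 0 ≤ shapeRow v x y r :=
  Finset.sum_nonneg fun _ _ => by unfold boxAt; split_ifs <;> simp

namespace IsGrowth

variable {N : ℕ} {h v : ℕ → ℕ → ℕ}

theorem shapeRow_zero_right (G : IsGrowth N h v) (x : ℕ) {r : ℕ} (hr : 1 ≤ r) :
    shapeRow v x 0 r = 0 :=
  Finset.sum_eq_zero fun x' _ => by rw [G.top, boxAt, if_neg (by omega)]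

theorem shapeRow_succ_right (G : IsGrowth N h v) (x y : ℕ) {r : ℕ} (hr : 1 ≤ r)
    (hxy : x + y + 1 ≤ N) :
    shapeRow v x (y + 1) r = shapeRow v x y r + boxAt (h x y) r := by
  induction x with
  | zero => simp [shapeRow, boxAt, G.left]; omega
  | succ x ih =>
    rw [shapeRow_succ_left, shapeRow_succ_left, ih (by omega), G.row x y (by omega),
      G.col x y (by omega)]
    unfold boxAt unbump
    split_ifs <;> omega

theorem shapeRow_antitone (G : IsGrowth N h v) (x y : ℕ) {r : ℕ} (hr : 1 ≤ r)
    (hxy : x + y ≤ N) : shapeRow v x y (r + 1) ≤ shapeRow v x y r := by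
  induction x generalizing y with
  | zero => simp [shapeRow]
  | succ x ihx =>
    induction y with
    | zero => rw [G.shapeRow_zero_right _ hr, G.shapeRow_zero_right _ (by omega)]
    | succ y ihy =>
      have h1 := ihx y (by omega)
      have h2 := ihx (y + 1) (by omega)
      have h3 := ihy (by omega)
      simp only [shapeRow_succ_left, G.shapeRow_succ_right x y hr (by omega),
        G.shapeRow_succ_right x y (by omega : 1 ≤ r + 1) (by omega)] at h2 h3 ⊢
      rw [G.row x y (by omega)] at h2 ⊢
      rw [G.col x y (by omega)] at h3
      exact add_boxAt_le hr h1 h2 h3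

end IsGrowth

/-- Every closed walk of partition shapes, given by the shapes `S x` preceding the `x`-th pair of
steps and the step labels `D x` (downwards) and `U x` (upwards), is the diagonal of a growth
diagram. -/
theorem exists_growth_of_walk (N : ℕ) (D U : ℕ → ℕ) (S : ℕ → ℕ → ℤ)
    (h0 : ∀ r, 1 ≤ r → S 0 r = 0) (hN : ∀ r, 1 ≤ r → S N r = 0)
    (hS : ∀ x ≤ N, ∀ r, 1 ≤ r → S x (r + 1) ≤ S x r ∧ 0 ≤ S x r)
    (hSD : ∀ x < N, ∀ r, 1 ≤ r → S x (r + 1) - boxAt (D x) (r + 1) ≤ S x r - boxAt (D x) r ∧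
      0 ≤ S x r - boxAt (D x) r)
    (hstep : ∀ x < N, ∀ r, 1 ≤ r → S (x + 1) r = S x r - boxAt (D x) r + boxAt (U x) r) :
    ∃ h v, IsGrowth N h v ∧ ∀ t < N, h t (N - 1 - t) = D t ∧ v t (N - 1 - t) = U t := by
  induction N generalizing D U S with
  | zero =>
    exact ⟨fun _ _ => 0, fun _ _ => 0, ⟨fun _ => rfl, fun _ => rfl, by omega, by omega⟩, by omega⟩
  | succ N ih =>
    have hD0 : D 0 = 0 := by
      by_contra hne
      have h1 := (hSD 0 (by omega) (D 0) (by omega)).2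
      rw [h0 _ (by omega), boxAt, if_pos rfl] at h1
      omega
    have hUN : U N = 0 := by
      by_contra hne
      have h1 := (hSD N (by omega) (U N) (by omega)).2
      have h2 := hstep N (by omega) (U N) (by omega)
      rw [hN _ (by omega), boxAt, boxAt, if_pos rfl] at h2
      rw [boxAt] at h1
      omega
    obtain ⟨h, v, G, hd⟩ := ih (fun x => unbump (D (x + 1)) (U x))
      (fun x => unbump (U x) (D (x + 1))) (fun x r => S x r - boxAt (D x) r)
      (fun r hr => by simp only [h0 r hr, hD0, boxAt]; split_ifs <;> omega)
      (fun r hr => by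
        have h1 := hstep N (by omega) r hr
        rw [hN r hr, hUN, boxAt, boxAt, if_neg (by omega : 0 ≠ r)] at h1
        rw [boxAt]
        omega)
      (fun x hx => hSD x (by omega))
      (fun x hx r hr => by
        have h1 := hSD x (by omega) r hr
        have h2 := hSD (x + 1) (by omega) r hr
        have h3 := (hS (x + 1) (by omega) r hr).1
        have h4 := (hSD (x + 1) (by omega) (r + 1) (by omega)).2
        have h5 : ∀ r, 1 ≤ r → S x r - boxAt (D x) r = S (x + 1) r - boxAt (U x) r :=
          fun r hr => eq_sub_of_add_eq (hstep x (by omega) r hr).symm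
        simp only [h5 r hr, h5 (r + 1) (by omega)] at h1 ⊢
        exact ⟨sub_boxAt_le hr h3 h2.1 h1.1, sub_boxAt_nonneg hr h3 h2.2 h1.2 h4⟩)
      (fun x hx r hr => by
        have h4 := hstep x (by omega) r hr
        simp only [h4]
        unfold boxAt unbump
        split_ifs <;> omega)
    let h' : ℕ → ℕ → ℕ := fun x y => if x + y = N then D x else h x y
    let v' : ℕ → ℕ → ℕ := fun x y => if x + y = N then U x else v x y
    have hh : ∀ x y, x + y ≠ N → h' x y = h x y := fun x y hxy => if_neg hxy
    have hv : ∀ x y, x + y ≠ N → v' x y = v x y := fun x y hxy => if_neg hxy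
    have hh' : ∀ x y, x + y = N → h' x y = D x := fun x y hxy => if_pos hxy
    have hv' : ∀ x y, x + y = N → v' x y = U x := fun x y hxy => if_pos hxy
    refine ⟨h', v', ⟨fun y => ?_, fun x => ?_, fun x y hxy => ?_, fun x y hxy => ?_⟩,
      fun t ht => ⟨hh' _ _ (by omega), hv' _ _ (by omega)⟩⟩
    · by_cases hy : 0 + y = N
      · rw [hh' _ _ hy, hD0]
      · rw [hh _ _ hy, G.left]
    · by_cases hx : x + 0 = N
      · rw [hv' _ _ hx, show x = N from hx, hUN]
      · rw [hv _ _ hx, G.top]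
    all_goals by_cases hxN : x + 1 + y = N
    · rw [hh' (x + 1) y hxN, hv' x (y + 1) (by omega), hh x y (by omega), ← (hd x (by omega)).1]
      congr 1; omega
    · rw [hh _ _ hxN, hv _ _ (by omega), hh _ _ (by omega)]
      exact G.row x y (by omega)
    · rw [hh' (x + 1) y hxN, hv' x (y + 1) (by omega), hv x y (by omega), ← (hd x (by omega)).2]
      congr 1; omega
    · rw [hh _ _ hxN, hv _ _ (by omega), hv _ _ (by omega)]
      exact G.col x y (by omega)
section Arcs

variable {N : ℕ} {P Q : Finpartition (Finset.univ : Finset (Fin N))} {a b c : Fin N}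

theorem isArc_iff : IsArc P a b ↔ a < b ∧ b ∈ P.part a ∧ ∀ c ∈ P.part a, ¬ (a < c ∧ c < b) := by
  constructor
  · rintro ⟨hab, B, hB, ha, hb, hc⟩
    rw [P.part_eq_of_mem hB ha]
    exact ⟨hab, hb, hc⟩
  · rintro ⟨hab, hb, hc⟩
    exact ⟨hab, P.part a, P.part_mem.2 (mem_univ _), P.mem_part (mem_univ _), hb, hc⟩

theorem part_eq_part (h : b ∈ P.part a) : P.part a = P.part b :=
  (P.part_eq_of_mem (P.part_mem.2 (mem_univ _)) h).symm

theorem IsArc.right_unique (h1 : IsArc P a b) (h2 : IsArc P a c) : b = c := by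
  rw [isArc_iff] at h1 h2
  by_contra hne
  rcases lt_or_gt_of_ne hne with h | h
  · exact h2.2.2 b h1.2.1 ⟨h1.1, h⟩
  · exact h1.2.2 c h2.2.1 ⟨h2.1, h⟩

theorem IsArc.left_unique (h1 : IsArc P a c) (h2 : IsArc P b c) : a = b := by
  rw [isArc_iff] at h1 h2
  have hp : P.part a = P.part b := (part_eq_part h1.2.1).trans (part_eq_part h2.2.1).symm
  by_contra hne
  rcases lt_or_gt_of_ne hne with h | h
  · exact h1.2.2 b (hp ▸ P.mem_part (mem_univ _)) ⟨h, h2.1⟩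
  · exact h2.2.2 a (hp ▸ P.mem_part (mem_univ _)) ⟨h, h1.1⟩

theorem mem_part_of_reflTransGen (h : Relation.ReflTransGen (IsArc P) a b) :
    b ∈ P.part a := by
  induction h with
  | refl => exact P.mem_part (mem_univ _)
  | tail _ hbc ih =>
    rw [part_eq_part ih]
    exact (isArc_iff.1 hbc).2.1

theorem reflTransGen_of_mem_part (n : ℕ) (hn : (b : ℕ) - a ≤ n) (hab : a ≤ b)
    (h : b ∈ P.part a) : Relation.ReflTransGen (IsArc P) a b := by
  induction n generalizing a b with
  | zero =>
    obtain rfl : a = b := by omega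
    exact .refl
  | succ n ih =>
    rcases hab.eq_or_lt with rfl | hlt
    · exact .refl
    by_cases harc : IsArc P a b
    · exact .single harc
    rw [isArc_iff] at harc
    push Not at harc
    obtain ⟨c, hc, hac, hcb⟩ := harc hlt h
    exact (ih (by omega) hac.le hc).trans (ih (by omega) hcb.le (part_eq_part hc ▸ h))

theorem mem_part_iff_reflTransGen : b ∈ P.part a ↔
    Relation.ReflTransGen (IsArc P) a b ∨ Relation.ReflTransGen (IsArc P) b a := by
  have hsymm : ∀ {a b}, b ∈ P.part a → a ∈ P.part b := fun h =>
    part_eq_part h ▸ P.mem_part (mem_univ _)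
  constructor
  · intro h
    rcases le_total a b with hab | hab
    · exact .inl (reflTransGen_of_mem_part _ le_rfl hab h)
    · exact .inr (reflTransGen_of_mem_part _ le_rfl hab (hsymm h))
  · rintro (h | h)
    · exact mem_part_of_reflTransGen h
    · exact hsymm (mem_part_of_reflTransGen h)

/-- A partition is determined by its arcs. -/
theorem eq_of_isArc_iff (h : ∀ a b, IsArc P a b ↔ IsArc Q a b) : P = Q := by
  have hPQ : IsArc P = IsArc Q := by
    funext a b
    exact propext (h a b)
  have hpart : ∀ a, P.part a = Q.part a := fun a => by
    ext b
    rw [mem_part_iff_reflTransGen, mem_part_iff_reflTransGen, hPQ]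
  have hmem : ∀ (R : Finpartition (Finset.univ : Finset (Fin N))) (B : Finset (Fin N)),
      B ∈ R.parts ↔ ∃ a, R.part a = B := fun R B => by
    constructor
    · intro hB
      obtain ⟨a, ha⟩ := R.nonempty_of_mem_parts hB
      exact ⟨a, R.part_eq_of_mem hB ha⟩
    · rintro ⟨a, rfl⟩
      exact R.part_mem.2 (mem_univ _)
  ext B
  simp only [hmem, hpart]

/-- Every increasing relation that is functional in both directions is the set of arcs of
a partition. -/
theorem exists_finpartition_of_arcs (X : Fin N → Fin N → Prop) (hlt : ∀ a b, X a b → a < b)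
    (hr : ∀ a b c, X a b → X a c → b = c) (hl : ∀ a b c, X a c → X b c → a = b) :
    ∃ P : Finpartition (Finset.univ : Finset (Fin N)), ∀ a b, IsArc P a b ↔ X a b := by
  classical
  have hle : ∀ {a b}, Relation.ReflTransGen X a b → a ≤ b := fun h => by
    induction h with
    | refl => exact le_rfl
    | tail _ hbc ih => exact ih.trans (hlt _ _ hbc).le
  have htot : ∀ {a b c}, Relation.ReflTransGen X a b → Relation.ReflTransGen X a c →
      Relation.ReflTransGen X b c ∨ Relation.ReflTransGen X c b := fun h1 h2 =>
    Relation.ReflTransGen.total_of_right_unique (fun a b c => hr a b c) h1 h2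
  have htot' : ∀ {a b c}, Relation.ReflTransGen X b a → Relation.ReflTransGen X c a →
      Relation.ReflTransGen X b c ∨ Relation.ReflTransGen X c b := fun h1 h2 => by
    have := Relation.ReflTransGen.total_of_right_unique (r := Function.swap X)
      (fun a b c h h' => hl b c a h h') (Relation.reflTransGen_swap.2 h1)
      (Relation.reflTransGen_swap.2 h2)
    exact this.symm.imp Relation.reflTransGen_swap.1 Relation.reflTransGen_swap.1
  let s : Setoid (Fin N) :=
    { r := fun a b => Relation.ReflTransGen X a b ∨ Relation.ReflTransGen X b a
      iseqv := ⟨fun _ => .inl .refl, Or.symm, by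
        rintro a b c (h1 | h1) (h2 | h2)
        · exact .inl (h1.trans h2)
        · exact htot' h1 h2
        · exact htot h1 h2
        · exact .inr (h2.trans h1)⟩ }
  have hs : ∀ a b, b ∈ (Finpartition.ofSetoid s).part a ↔
      Relation.ReflTransGen X a b ∨ Relation.ReflTransGen X b a :=
    fun a b => Finpartition.mem_part_ofSetoid_iff_rel
  refine ⟨Finpartition.ofSetoid s, fun a b => ?_⟩
  simp only [isArc_iff, hs]
  constructor
  · rintro ⟨hab, h | h, hc⟩
    · rcases Relation.ReflTransGen.cases_head h with rfl | ⟨c, h1, h2⟩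
      · exact absurd hab (lt_irrefl _)
      · rcases (hle h2).eq_or_lt with rfl | hcb
        · exact h1
        · exact absurd ⟨hlt _ _ h1, hcb⟩ (hc c (.inl (.single h1)))
    · exact absurd (hle h) (not_le.2 hab)
  · intro hX
    refine ⟨hlt _ _ hX, .inl (.single hX), ?_⟩
    rintro c (h | h) ⟨h1, h2⟩
    · rcases Relation.ReflTransGen.cases_head h with rfl | ⟨d, h3, h4⟩
      · exact absurd h1 (lt_irrefl _)
      · obtain rfl := hr _ _ _ hX h3
        exact absurd (hle h4) (not_le.2 h2)
    · exact absurd (hle h) (not_le.2 h1)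

/-- The arcs of `P` are the `1`-points of the growth diagram. -/
def ArcsAre (P : Finpartition (Finset.univ : Finset (Fin N))) (h v : ℕ → ℕ → ℕ) : Prop :=
  ∀ i j : Fin N, IsArc P i j ↔ IsPt N h v 1 i (N - 1 - j)

variable {h v : ℕ → ℕ → ℕ}

theorem ArcsAre.isPt_iff (hP : ArcsAre P h v) {x y : ℕ} (hxy : x + y + 1 < N) :
    IsPt N h v 1 x y ↔ IsArc P ⟨x, by omega⟩ ⟨N - 1 - y, by omega⟩ := by
  rw [hP]
  simp only
  rw [show N - 1 - (N - 1 - y) = y by omega]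

theorem exists_growth_of_partition (P : Finpartition (Finset.univ : Finset (Fin N))) :
    ∃ h v, IsGrowth N h v ∧ ArcsAre P h v := by
  obtain ⟨h, v, G, hX⟩ := exists_growth_of_pts N
    (fun x y => ∃ i j : Fin N, (i : ℕ) = x ∧ N - 1 - (j : ℕ) = y ∧ IsArc P i j)
    (by
      rintro x x' y ⟨i, j, rfl, rfl, h1⟩ ⟨i', j', rfl, hj, h2⟩
      obtain rfl : j = j' := by omega
      rw [h1.left_unique h2])
    (by
      rintro x y y' ⟨i, j, rfl, rfl, h1⟩ ⟨i', j', hi, rfl, h2⟩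
      obtain rfl : i = i' := by omega
      rw [h1.right_unique h2])
  refine ⟨h, v, G, fun i j => ?_⟩
  constructor
  · intro hij
    exact (hX _ _ (by have : i < j := hij.1; omega)).1 ⟨i, j, rfl, rfl, hij⟩
  · intro hp
    obtain ⟨i', j', hi, hj, h1⟩ := (hX _ _ hp.1).2 hp
    obtain rfl : i = i' := by omega
    obtain rfl : j = j' := by omega
    exact h1

theorem IsGrowth.exists_partition (G : IsGrowth N h v) :
    ∃ P : Finpartition (Finset.univ : Finset (Fin N)), ArcsAre P h v :=
  exists_finpartition_of_arcs (fun i j => IsPt N h v 1 i (N - 1 - j))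
    (fun a b hab => by have := hab.1; omega)
    (fun a b c h1 h2 => by have := G.pt_one_col_unique h1 h2; omega)
    (fun a b c h1 h2 => by have := G.pt_one_row_unique h1 h2; omega)

theorem ArcsAre.hasKCrossing_iff (hP : ArcsAre P h v) {k : ℕ} (hk : 1 ≤ k) :
    PartitionHasKCrossing k P ↔ ∃ X Y, IsPtChain N h v 1 k X Y := by
  obtain ⟨m, rfl⟩ : ∃ m, k = m + 1 := ⟨k - 1, by omega⟩
  constructor
  · rintro ⟨ii, jj, h1, h2, h3, h4⟩
    refine ⟨fun s => ii (Fin.ofNat (m + 1) s), fun s => N - 1 - jj (Fin.ofNat (m + 1) s),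
      fun s hs => (hP _ _).1 (h1 _), fun s hs => ?_, ?_⟩
    · have hlt : Fin.ofNat (m + 1) s < Fin.ofNat (m + 1) (s + 1) := by
        simp only [Fin.lt_def, Fin.val_ofNat]
        rw [Nat.mod_eq_of_lt (by omega), Nat.mod_eq_of_lt hs]
        omega
      have h5 : ii _ < ii _ := h2 hlt
      have h6 : jj _ < jj _ := h3 hlt
      exact ⟨h5, by dsimp only; omega⟩
    · have h5 : ii _ < jj _ := h4 (Fin.ofNat (m + 1) (m + 1 - 1)) (Fin.ofNat (m + 1) 0)
      dsimp only
      omega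
  · rintro ⟨X, Y, h1, h2, h3⟩
    have hb : ∀ s : Fin (m + 1), X s + Y s + 1 < N := fun s => (h1 s s.2).1
    let ii : Fin (m + 1) → Fin N := fun s => ⟨X s, by have := hb s; omega⟩
    let jj : Fin (m + 1) → Fin N := fun s => ⟨N - 1 - Y s, by have := hb s; omega⟩
    have hii : StrictMono ii := Fin.strictMono_iff_lt_succ.2 fun s => by
      have := (h2 s (by omega)).1
      simpa [ii, Fin.lt_def] using this
    have hjj : StrictMono jj := Fin.strictMono_iff_lt_succ.2 fun s => by
      have h4 := (h2 s (by omega)).2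
      have h5 := hb s.castSucc
      simp only [Fin.val_castSucc] at h5
      simp only [jj, Fin.lt_def, Fin.val_castSucc, Fin.val_succ]
      omega
    refine ⟨ii, jj, fun s => ?_, hii, hjj, fun s s' => ?_⟩
    · exact (hP.isPt_iff (hb s)).1 (h1 s s.2)
    · refine (hii.monotone (Fin.le_last s)).trans_lt (lt_of_lt_of_le ?_
        (hjj.monotone (Fin.zero_le s')))
      simp only [ii, jj, Fin.lt_def, Fin.val_last, Fin.val_zero]
      simp only [Nat.add_sub_cancel] at h3
      omega

end Arcs
/-- The steps of the walk `w` starting at `δ` are the labels on the diagonal of the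
growth diagram, all of which are less than `k`. -/
def IsDiag (k N : ℕ) (h v : ℕ → ℕ → ℕ) (w : Fin (2 * N + 1) → Pt k) : Prop :=
  w 0 = delta k ∧ ∀ t, ∀ ht : t < N, h t (N - 1 - t) < k ∧ v t (N - 1 - t) < k ∧
    ∀ i : Fin (k - 1),
      w ⟨2 * t + 1, by omega⟩ i - w ⟨2 * t, by omega⟩ i = -boxAt (h t (N - 1 - t)) (i + 1) ∧
      w ⟨2 * t + 2, by omega⟩ i - w ⟨2 * t + 1, by omega⟩ i = boxAt (v t (N - 1 - t)) (i + 1)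

theorem eVec_apply {k : ℕ} (a : Fin k) (i : Fin (k - 1)) : eVec k a i = boxAt a (i + 1) := by
  simp only [eVec, boxAt, eq_comm]

theorem boxAt_injective {k a b : ℕ} (ha : a < k) (hb : b < k)
    (h : ∀ i : Fin (k - 1), boxAt a (i + 1) = boxAt b (i + 1)) : a = b := by
  by_contra hne
  rcases Nat.eq_zero_or_pos a with rfl | ha0
  · have := h ⟨b - 1, by omega⟩
    simp only [boxAt] at this
    split_ifs at this <;> omega
  · have := h ⟨a - 1, by omega⟩
    simp only [boxAt] at this
    split_ifs at this <;> omega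

namespace IsDiag

variable {k N : ℕ} {h v h' v' : ℕ → ℕ → ℕ} {w w' : Fin (2 * N + 1) → Pt k}

theorem walk_unique (hw : IsDiag k N h v w) (hw' : IsDiag k N h v w') : w = w' := by
  have aux : ∀ t, ∀ ht : t ≤ N, w ⟨2 * t, by omega⟩ = w' ⟨2 * t, by omega⟩ := fun t => by
    induction t with
    | zero => exact fun _ => hw.1.trans hw'.1.symm
    | succ t ih =>
      intro ht
      funext i
      have h1 := congrFun (ih (by omega)) i
      have h2 := (hw.2 t (by omega)).2.2 i
      have h3 := (hw'.2 t (by omega)).2.2 i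
      simp only [show 2 * (t + 1) = 2 * t + 2 by omega]
      omega
  funext ⟨s, hs⟩
  obtain ⟨t, rfl | rfl⟩ := Nat.even_or_odd' s
  · exact aux t (by omega)
  · funext i
    have h1 := congrFun (aux t (by omega)) i
    have h2 := (hw.2 t (by omega)).2.2 i
    have h3 := (hw'.2 t (by omega)).2.2 i
    omega

theorem labels_unique (hw : IsDiag k N h v w) (hw' : IsDiag k N h' v' w) (t : ℕ) (ht : t < N) :
    h t (N - 1 - t) = h' t (N - 1 - t) ∧ v t (N - 1 - t) = v' t (N - 1 - t) := by
  obtain ⟨h1, h2, h3⟩ := hw.2 t ht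
  obtain ⟨h4, h5, h6⟩ := hw'.2 t ht
  exact ⟨boxAt_injective h1 h4 fun i => by have := h3 i; have := h6 i; omega,
    boxAt_injective h2 h5 fun i => by have := h3 i; have := h6 i; omega⟩

theorem congr_labels (hw : IsDiag k N h v w)
    (hd : ∀ t < N, h t (N - 1 - t) = h' t (N - 1 - t) ∧ v t (N - 1 - t) = v' t (N - 1 - t)) :
    IsDiag k N h' v' w :=
  ⟨hw.1, fun t ht => by rw [← (hd t ht).1, ← (hd t ht).2]; exact hw.2 t ht⟩

end IsDiag

/-- The number of boxes in row `r ≥ 1` of the partition shape `p - δ`. -/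
def rowLength {k : ℕ} (p : Pt k) (r : ℕ) : ℤ :=
  if hr : r - 1 < k - 1 then p ⟨r - 1, hr⟩ - delta k ⟨r - 1, hr⟩ else 0

theorem rowLength_antitone {k : ℕ} {p : Pt k} (hp : inW p) {r : ℕ} (hr : 1 ≤ r) :
    rowLength p (r + 1) ≤ rowLength p r := by
  unfold rowLength delta
  split_ifs with h1 h2 h2
  · have := hp.1 (show (⟨r - 1, h2⟩ : Fin (k - 1)) < ⟨r + 1 - 1, h1⟩ by
      simp only [Fin.lt_def]; omega)
    dsimp only
    omega
  · omega
  · have := hp.2 ⟨r - 1, h2⟩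
    dsimp only
    omega
  · exact le_rfl

theorem rowLength_nonneg {k : ℕ} {p : Pt k} (hp : inW p) {r : ℕ} (hr : 1 ≤ r) :
    0 ≤ rowLength p r := by
  have h1 : ∀ n, rowLength p (r + n) ≤ rowLength p r := fun n => by
    induction n with
    | zero => exact le_rfl
    | succ n ih => exact (rowLength_antitone hp (show 1 ≤ r + n by omega)).trans ih
  have h2 := h1 k
  rwa [rowLength, dif_neg (by omega)] at h2

theorem inW_of_rows {k : ℕ} {p : Pt k} {f : ℕ → ℤ} (hp : ∀ i, p i = delta k i + f (i + 1))
    (hf : ∀ r, 1 ≤ r → f (r + 1) ≤ f r) (hf0 : ∀ r, 0 ≤ f r) : inW p := by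
  constructor
  · intro i j hij
    have h1 : ∀ n, f (i + 1 + n) ≤ f (i + 1) := fun n => by
      induction n with
      | zero => exact le_rfl
      | succ n ih => exact (hf (i + 1 + n) (by omega)).trans ih
    have h2 := h1 (j - i)
    have h3 : (i : ℕ) < j := hij
    rw [show (i : ℕ) + 1 + (j - i) = j + 1 by omega] at h2
    rw [hp, hp]
    unfold delta
    omega
  · intro i
    have h1 := hf0 (i + 1)
    have h2 := i.2
    rw [hp]
    unfold delta
    omega

theorem IsGrowth.exists_walk {k N : ℕ} {h v : ℕ → ℕ → ℕ} (G : IsGrowth N h v)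
    (hd : ∀ t < N, h t (N - 1 - t) < k ∧ v t (N - 1 - t) < k) :
    ∃ w : Fin (2 * N + 1) → Pt k, (IsPWalk (inW (k := k)) (2 * N) w ∧
      w (Fin.last (2 * N)) = delta k) ∧ IsDiag k N h v w := by
  let w : Fin (2 * N + 1) → Pt k := fun s i =>
    delta k i + shapeRow v (s / 2) (N - (s + 1) / 2) (i + 1)
  have hdown : ∀ t, ∀ ht : t < N, ∀ i : Fin (k - 1), w ⟨2 * t + 1, by omega⟩ i -
      w ⟨2 * t, by omega⟩ i = -boxAt (h t (N - 1 - t)) (i + 1) := fun t ht i => by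
    have h1 := G.shapeRow_succ_right t (N - 1 - t) (show 1 ≤ (i : ℕ) + 1 by omega) (by omega)
    simp only [w]
    rw [show (2 * t + 1) / 2 = t by omega, show 2 * t / 2 = t by omega,
      show N - t = N - 1 - t + 1 by omega, show N - (2 * t + 1 + 1) / 2 = N - 1 - t by omega, h1]
    ring
  have hup : ∀ t, ∀ ht : t < N, ∀ i : Fin (k - 1), w ⟨2 * t + 2, by omega⟩ i -
      w ⟨2 * t + 1, by omega⟩ i = boxAt (v t (N - 1 - t)) (i + 1) := fun t ht i => by
    simp only [w]
    rw [show (2 * t + 2) / 2 = t + 1 by omega, show (2 * t + 1) / 2 = t by omega,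
      show N - (2 * t + 2 + 1) / 2 = N - 1 - t by omega,
      show N - (t + 1) = N - 1 - t by omega, shapeRow_succ_left]
    ring
  have h0 : w 0 = delta k := by
    funext i
    simp [w, shapeRow]
  refine ⟨w, ⟨⟨h0, fun s => ?_, fun s hs => ⟨fun hodd => ?_, fun heven => ?_⟩⟩, ?_⟩,
    h0, fun t ht => ⟨(hd t ht).1, (hd t ht).2, fun i => ⟨hdown t ht i, hup t ht i⟩⟩⟩
  · exact inW_of_rows (f := shapeRow v (s / 2) (N - (s + 1) / 2)) (fun i => rfl)
      (fun r hr => G.shapeRow_antitone _ _ hr (by omega)) (fun r => shapeRow_nonneg _ _ _ _)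
  · obtain ⟨t, ht⟩ := hodd
    obtain rfl : s = 2 * t := by omega
    refine ⟨⟨_, (hd t (by omega)).1⟩, ?_⟩
    funext i
    rw [Pi.sub_apply, Pi.neg_apply, eVec_apply]
    exact hdown t (by omega) i
  · obtain ⟨t, ht⟩ := heven.exists_two_nsmul
    obtain ⟨t, rfl⟩ : ∃ u, t = u + 1 := ⟨t - 1, by simp at ht; omega⟩
    obtain rfl : s = 2 * t + 1 := by simp at ht; omega
    refine ⟨⟨_, (hd t (by omega)).2⟩, ?_⟩
    funext i
    rw [Pi.sub_apply, eVec_apply]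
    exact hup t (by omega) i
  · funext i
    simp only [w, Fin.val_last]
    rw [show N - (2 * N + 1) / 2 = 0 by omega, G.shapeRow_zero_right _ (by omega), add_zero]

theorem IsPWalk.exists_growth {k N : ℕ} {w : Fin (2 * N + 1) → Pt k}
    (hw : IsPWalk (inW (k := k)) (2 * N) w) (hlast : w (Fin.last (2 * N)) = delta k) :
    ∃ h v, IsGrowth N h v ∧ IsDiag k N h v w := by
  obtain ⟨h0, hW, hstep⟩ := hw
  have hdown : ∀ t, ∃ a, ∀ ht : t < N, a < k ∧ ∀ i : Fin (k - 1), w ⟨2 * t + 1, by omega⟩ i -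
      w ⟨2 * t, by omega⟩ i = -boxAt a (i + 1) := fun t => by
    by_cases ht : t < N
    · obtain ⟨a, ha⟩ := (hstep (2 * t) (by omega)).1 ⟨t, rfl⟩
      refine ⟨a, fun _ => ⟨a.2, fun i => ?_⟩⟩
      have := congrFun ha i
      rwa [Pi.sub_apply, Pi.neg_apply, eVec_apply] at this
    · exact ⟨0, fun h => absurd h ht⟩
  have hup : ∀ t, ∃ a, ∀ ht : t < N, a < k ∧ ∀ i : Fin (k - 1), w ⟨2 * t + 2, by omega⟩ i -
      w ⟨2 * t + 1, by omega⟩ i = boxAt a (i + 1) := fun t => by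
    by_cases ht : t < N
    · obtain ⟨a, ha⟩ := (hstep (2 * t + 1) (by omega)).2 ⟨t + 1, by omega⟩
      refine ⟨a, fun _ => ⟨a.2, fun i => ?_⟩⟩
      have := congrFun ha i
      rwa [Pi.sub_apply, eVec_apply] at this
    · exact ⟨0, fun h => absurd h ht⟩
  choose D hD using hdown
  choose U hU using hup
  let W : ℕ → Pt k := fun s => if hs : s < 2 * N + 1 then w ⟨s, hs⟩ else delta k
  have hWw : ∀ s (hs : s < 2 * N + 1), W s = w ⟨s, hs⟩ := fun s hs => dif_pos hs
  have hrow0 : ∀ r, rowLength (delta k) r = 0 := fun r => by simp [rowLength]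
  have hWD : ∀ x < N, ∀ r, 1 ≤ r →
      rowLength (W (2 * x)) r - boxAt (D x) r = rowLength (W (2 * x + 1)) r := fun x hx r hr => by
    have h1 := hD x hx
    rw [hWw _ (by omega), hWw _ (by omega)]
    unfold rowLength
    split_ifs with h2
    · have h3 := h1.2 ⟨r - 1, h2⟩
      dsimp only at h3
      rw [Nat.sub_add_cancel hr] at h3
      omega
    · rw [boxAt, if_neg (by omega), sub_zero]
  have hWU : ∀ x < N, ∀ r, 1 ≤ r → rowLength (W (2 * x + 2)) r =
      rowLength (W (2 * x + 1)) r + boxAt (U x) r := fun x hx r hr => by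
    have h1 := hU x hx
    rw [hWw _ (by omega), hWw _ (by omega)]
    unfold rowLength
    split_ifs with h2
    · have h3 := h1.2 ⟨r - 1, h2⟩
      dsimp only at h3
      rw [Nat.sub_add_cancel hr] at h3
      omega
    · rw [boxAt, if_neg (by omega), add_zero]
  obtain ⟨h, v, G, hd⟩ := exists_growth_of_walk N D U (fun x r => rowLength (W (2 * x)) r)
    (fun r _ => by
      rw [hWw _ (by omega)]
      exact (congrArg (rowLength · r) h0).trans (hrow0 r))
    (fun r _ => by
      rw [hWw _ (by omega)]
      exact (congrArg (rowLength · r) hlast).trans (hrow0 r))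
    (fun x hx r hr => by
      rw [hWw _ (by omega)]
      exact ⟨rowLength_antitone (hW _) hr, rowLength_nonneg (hW _) hr⟩)
    (fun x hx r hr => by
      rw [hWD x hx r hr, hWD x hx (r + 1) (by omega), hWw _ (by omega)]
      exact ⟨rowLength_antitone (hW _) hr, rowLength_nonneg (hW _) hr⟩)
    (fun x hx r hr => by
      rw [hWD x hx r hr]
      exact hWU x hx r hr)
  refine ⟨h, v, G, h0, fun t ht => ?_⟩
  rw [(hd t ht).1, (hd t ht).2]
  exact ⟨(hD t ht).1, (hU t ht).1, fun i => ⟨(hD t ht).2 i, (hU t ht).2 i⟩⟩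

/-- For `k ≥ 3` and `N ≥ 1`, the number of `k`-noncrossing partitions
of `[N]` equals the number of `𝒫_{W_{k-1}}`-walks of length `2N` from `δ` to `δ`. -/
theorem partitions_eq_PWalks (k N : ℕ) (hk : 3 ≤ k) (hN : 1 ≤ N) :
    Nat.card {P : Finpartition (Finset.univ : Finset (Fin N)) //
        ¬ PartitionHasKCrossing k P} =
    Nat.card {v : Fin (2 * N + 1) → Pt k //
        IsPWalk (inW (k := k)) (2 * N) v ∧ v (Fin.last (2 * N)) = delta k} := by
  have hk1 : 1 ≤ k := by omega
  have hex : ∀ P : {P : Finpartition (Finset.univ : Finset (Fin N)) //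
      ¬ PartitionHasKCrossing k P}, ∃ w : {v : Fin (2 * N + 1) → Pt k //
        IsPWalk (inW (k := k)) (2 * N) v ∧ v (Fin.last (2 * N)) = delta k},
      ∃ h v, IsGrowth N h v ∧ ArcsAre P.1 h v ∧ IsDiag k N h v w.1 := by
    rintro ⟨P, hP⟩
    obtain ⟨h, v, G, hA⟩ := exists_growth_of_partition P
    obtain ⟨w, hw, hd⟩ := G.exists_walk ((G.diag_lt_iff hk1).2 ((hA.hasKCrossing_iff hk1).not.1 hP))
    exact ⟨⟨w, hw⟩, h, v, G, hA, hd⟩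
  choose f hf using hex
  refine Nat.card_eq_of_bijective f ⟨fun P Q hPQ => ?_, fun w => ?_⟩
  · obtain ⟨h, v, G, hA, hd⟩ := hf P
    obtain ⟨h', v', G', hA', hd'⟩ := hf Q
    rw [← hPQ] at hd'
    have heq := G.eq_of_diag G' (hd.labels_unique hd')
    refine Subtype.ext (eq_of_isArc_iff fun i j => ?_)
    rw [hA i j, hA' i j]
    refine and_congr_right fun hij => ?_
    rw [(heq (N - (i + 1 + (N - 1 - j) + 1)) _ _ (by omega)).1,
      (heq (N - (i + (N - 1 - j + 1) + 1)) _ _ (by omega)).2]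
  · obtain ⟨w, hw, hlast⟩ := w
    obtain ⟨h, v, G, hd⟩ := hw.exists_growth hlast
    obtain ⟨P, hA⟩ := G.exists_partition
    have hP : ¬ PartitionHasKCrossing k P := (hA.hasKCrossing_iff hk1).not.2
      ((G.diag_lt_iff hk1).1 fun t ht => ⟨(hd.2 t ht).1, (hd.2 t ht).2.1⟩)
    refine ⟨⟨P, hP⟩, Subtype.ext ?_⟩
    obtain ⟨h', v', G', hA', hd'⟩ := hf ⟨P, hP⟩
    have heq := G'.eq_of_pt G fun x y => by
      by_cases hxy : x + y + 1 < N
      · rw [hA.isPt_iff hxy, hA'.isPt_iff hxy]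
      · simp only [IsPt, hxy, false_and]
    exact (hd'.congr_labels fun t ht => heq _ t (N - 1 - t) rfl (by omega)).walk_unique hd
end

section
/- Fix an integer k ≥ 3 and N ≥ 1. The number of k-noncrossing braids over [N] equals the number of B_{W_{k-1}}-walks of length 2N that start at δ = (k−2, k−3, …, 1, 0) and end at δ. -/
open Finset

/-- Longest increasing chain of cells of `X` in `[0,a) × [0,b)`, given by Fomin's local rule for
the first row of a growth diagram. -/
noncomputable def lev (X : ℕ → ℕ → Prop) : ℕ → ℕ → ℕ
  | 0, _ => 0
  | _ + 1, 0 => 0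
  | a + 1, b + 1 =>
    open Classical in
    if X a b then lev X a b + 1 else max (lev X (a + 1) b) (lev X a (b + 1))
  termination_by a b => (a, b)

/-- Viennot's skeleton of a filling: the cells where the first row of the growth diagram bumps
a box to the second row. -/
def skel (X : ℕ → ℕ → Prop) (a b : ℕ) : Prop :=
  lev X (a + 1) b = lev X a b + 1 ∧ lev X a (b + 1) = lev X a b + 1

/-- `X` has at most one cell in every row and every column. -/
def IsPartialPerm (X : ℕ → ℕ → Prop) : Prop :=
  (∀ a b b', X a b → X a b' → b = b') ∧ ∀ a a' b, X a b → X a' b → a = a'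

/-- Some cell of `X` in column `a` lies below height `b`. -/
def ColHit (X : ℕ → ℕ → Prop) (a b : ℕ) : Prop := ∃ b' < b, X a b'

/-- Some cell of `X` in row `b` lies to the left of `a`. -/
def RowHit (X : ℕ → ℕ → Prop) (a b : ℕ) : Prop := ∃ a' < a, X a' b

lemma lev_zero_left (X : ℕ → ℕ → Prop) (b : ℕ) : lev X 0 b = 0 := by rw [lev]

lemma lev_zero_right (X : ℕ → ℕ → Prop) (a : ℕ) : lev X a 0 = 0 := by
  cases a <;> rw [lev]

lemma lev_succ_of_mem {X : ℕ → ℕ → Prop} {a b : ℕ} (h : X a b) :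
    lev X (a + 1) (b + 1) = lev X a b + 1 := by
  rw [lev, if_pos h]

lemma lev_succ_of_not_mem {X : ℕ → ℕ → Prop} {a b : ℕ} (h : ¬ X a b) :
    lev X (a + 1) (b + 1) = max (lev X (a + 1) b) (lev X a (b + 1)) := by
  rw [lev, if_neg h]

lemma colHit_succ {X : ℕ → ℕ → Prop} {a b : ℕ} :
    ColHit X a (b + 1) ↔ ColHit X a b ∨ X a b := by
  simp only [ColHit, Nat.lt_succ_iff_lt_or_eq]
  grind

lemma rowHit_succ {X : ℕ → ℕ → Prop} {a b : ℕ} :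
    RowHit X (a + 1) b ↔ RowHit X a b ∨ X a b := by
  simp only [RowHit, Nat.lt_succ_iff_lt_or_eq]
  grind

lemma not_colHit_zero {X : ℕ → ℕ → Prop} {a : ℕ} : ¬ ColHit X a 0 := by simp [ColHit]

lemma not_rowHit_zero {X : ℕ → ℕ → Prop} {b : ℕ} : ¬ RowHit X 0 b := by simp [RowHit]

namespace IsPartialPerm

variable {X : ℕ → ℕ → Prop}

open Classical in
/-- The increments of `lev` along the edges of the grid. -/
lemma lev_edges (hX : IsPartialPerm X) (n : ℕ) : ∀ a b, a + b = n →
    (lev X (a + 1) b = lev X a b + if ColHit X a b ∧ ¬ ColHit (skel X) a b then 1 else 0) ∧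
    (lev X a (b + 1) = lev X a b + if RowHit X a b ∧ ¬ RowHit (skel X) a b then 1 else 0) := by
  induction n using Nat.strong_induction_on with
  | _ n ih =>
    intro a b hab
    constructor
    · cases b with
      | zero => simp [lev_zero_right, not_colHit_zero]
      | succ b =>
        obtain ⟨h1, h2⟩ := ih (a + b) (by omega) a b rfl
        have hs : skel X a b ↔ lev X (a + 1) b = lev X a b + 1 ∧
          lev X a (b + 1) = lev X a b + 1 := Iff.rfl
        rw [colHit_succ, colHit_succ]
        by_cases hx : X a b
        · have hc : ¬ ColHit X a b := fun ⟨b', hb', h⟩ => by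
            have := hX.1 a b b' hx h; omega
          have hr : ¬ RowHit X a b := fun ⟨a', ha', h⟩ => by
            have := hX.2 a a' b hx h; omega
          rw [lev_succ_of_mem hx]
          have hc' : ¬ ColHit (skel X) a b := by
            rintro ⟨b', hb', h⟩
            have := (ih (a + b') (by omega) a b' rfl).1
            have h3 : ¬ ColHit X a b' := fun ⟨c, hc', h'⟩ => hc ⟨c, by omega, h'⟩
            simp only [h3, false_and, if_false] at this
            have := h.1
            omega
          simp only [hc, hr, false_and, if_false] at h1 h2
          have hs' : ¬ skel X a b := by rw [hs]; omega
          simp [hx, hc', hs', h2]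
        · rw [lev_succ_of_not_mem hx]
          by_cases hsk : skel X a b
          · have := hs.1 hsk
            simp [hsk, this.1, this.2]
          · have : ¬ (lev X (a + 1) b = lev X a b + 1 ∧
              lev X a (b + 1) = lev X a b + 1) := fun h => hsk (hs.2 h)
            simp only [hx, hsk, or_false]
            split_ifs at h1 h2 ⊢ <;> omega
    · cases a with
      | zero => simp [lev_zero_left, not_rowHit_zero]
      | succ a =>
        obtain ⟨h1, h2⟩ := ih (a + b) (by omega) a b rfl
        have hs : skel X a b ↔ lev X (a + 1) b = lev X a b + 1 ∧
          lev X a (b + 1) = lev X a b + 1 := Iff.rfl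
        rw [rowHit_succ, rowHit_succ]
        by_cases hx : X a b
        · have hc : ¬ ColHit X a b := fun ⟨b', hb', h⟩ => by
            have := hX.1 a b b' hx h; omega
          have hr : ¬ RowHit X a b := fun ⟨a', ha', h⟩ => by
            have := hX.2 a a' b hx h; omega
          rw [lev_succ_of_mem hx]
          have hr' : ¬ RowHit (skel X) a b := by
            rintro ⟨a', ha', h⟩
            have := (ih (a' + b) (by omega) a' b rfl).2
            have h3 : ¬ RowHit X a' b := fun ⟨c, hc', h'⟩ => hr ⟨c, by omega, h'⟩
            simp only [h3, false_and, if_false] at this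
            have := h.2
            omega
          simp only [hc, hr, false_and, if_false] at h1 h2
          have hs' : ¬ skel X a b := by rw [hs]; omega
          simp [hx, hr', hs', h1]
        · rw [lev_succ_of_not_mem hx]
          by_cases hsk : skel X a b
          · have := hs.1 hsk
            simp [hsk, this.1, this.2]
          · have : ¬ (lev X (a + 1) b = lev X a b + 1 ∧
              lev X a (b + 1) = lev X a b + 1) := fun h => hsk (hs.2 h)
            simp only [hx, hsk, or_false]
            split_ifs at h1 h2 ⊢ <;> omega

open Classical in
lemma lev_succ_left (hX : IsPartialPerm X) (a b : ℕ) :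
    lev X (a + 1) b = lev X a b + if ColHit X a b ∧ ¬ ColHit (skel X) a b then 1 else 0 :=
  (hX.lev_edges _ a b rfl).1

open Classical in
lemma lev_succ_right (hX : IsPartialPerm X) (a b : ℕ) :
    lev X a (b + 1) = lev X a b + if RowHit X a b ∧ ¬ RowHit (skel X) a b then 1 else 0 :=
  (hX.lev_edges _ a b rfl).2

lemma skel_iff (hX : IsPartialPerm X) {a b : ℕ} : skel X a b ↔
    (ColHit X a b ∧ ¬ ColHit (skel X) a b) ∧ RowHit X a b ∧ ¬ RowHit (skel X) a b := by
  rw [skel, hX.lev_succ_left, hX.lev_succ_right]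
  split_ifs <;> simp_all

lemma colHit_of_skel (hX : IsPartialPerm X) {a b : ℕ} (h : ColHit (skel X) a b) :
    ColHit X a b := by
  obtain ⟨b', hb', h⟩ := h
  obtain ⟨c, hc, h⟩ := (hX.skel_iff.1 h).1.1
  exact ⟨c, by omega, h⟩

lemma rowHit_of_skel (hX : IsPartialPerm X) {a b : ℕ} (h : RowHit (skel X) a b) :
    RowHit X a b := by
  obtain ⟨b', hb', h⟩ := h
  obtain ⟨c, hc, h⟩ := (hX.skel_iff.1 h).2.1
  exact ⟨c, by omega, h⟩

protected lemma skel (hX : IsPartialPerm X) : IsPartialPerm (skel X) := by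
  refine ⟨fun a b b' h h' => ?_, fun a a' b h h' => ?_⟩
  · rcases lt_trichotomy b b' with hb | hb | hb
    · exact absurd ⟨b, hb, h⟩ (hX.skel_iff.1 h').1.2
    · exact hb
    · exact absurd ⟨b', hb, h'⟩ (hX.skel_iff.1 h).1.2
  · rcases lt_trichotomy a a' with hb | hb | hb
    · exact absurd ⟨a, hb, h⟩ (hX.skel_iff.1 h').2.2
    · exact hb
    · exact absurd ⟨a', hb, h'⟩ (hX.skel_iff.1 h).2.2

lemma iterate_skel (hX : IsPartialPerm X) (r : ℕ) : IsPartialPerm (skel^[r] X) := by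
  induction r with
  | zero => exact hX
  | succ r ih => rw [Function.iterate_succ_apply']; exact ih.skel

lemma lev_le_succ_left (hX : IsPartialPerm X) (a b : ℕ) : lev X a b ≤ lev X (a + 1) b := by
  rw [hX.lev_succ_left]; omega

lemma lev_le_succ_right (hX : IsPartialPerm X) (a b : ℕ) : lev X a b ≤ lev X a (b + 1) := by
  rw [hX.lev_succ_right]; omega

/-- Between two cells in decreasing position lies a cell of the skeleton. -/
lemma exists_skel_between (hX : IsPartialPerm X) {t v t' v' : ℕ} (h : X t v) (h' : X t' v')
    (ht : t < t') (hv : v' < v) :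
    ∃ s w, skel X s w ∧ t < s ∧ s ≤ t' ∧ v' < w ∧ w ≤ v := by
  by_contra! hcon
  have hcon' : ∀ s w, skel X s w → t < s → s ≤ t' → v' < w → w ≤ v → False :=
    fun s w a b c d e => absurd e (not_le.2 (hcon s w a b c d))
  refine hcon' t' v (hX.skel_iff.2 ⟨⟨⟨v', hv, h'⟩, ?_⟩, ⟨t, ht, h⟩, ?_⟩) ht le_rfl hv le_rfl
  · rintro ⟨w, hw, hs⟩
    obtain ⟨c, hc, hXc⟩ := (hX.skel_iff.1 hs).1.1
    have := hX.1 _ _ _ hXc h'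
    exact hcon' t' w hs ht le_rfl (by omega) hw.le
  · rintro ⟨s, hs', hs⟩
    obtain ⟨c, hc, hXc⟩ := (hX.skel_iff.1 hs).2.1
    have := hX.2 _ _ _ hXc h
    exact hcon' s v hs (by omega) hs'.le hv le_rfl

/-- Between two cells of the skeleton in decreasing position lies a cell of the filling. -/
lemma exists_between_skel (hX : IsPartialPerm X) {t v t' v' : ℕ} (h : skel X t v)
    (h' : skel X t' v') (ht : t < t') (hv : v' < v) :
    ∃ s w, X s w ∧ t ≤ s ∧ s < t' ∧ v' ≤ w ∧ w < v := by
  obtain ⟨x, hx, hXx⟩ := (hX.skel_iff.1 h).1.1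
  obtain ⟨s, hs, hXs⟩ := (hX.skel_iff.1 h').2.1
  by_cases h1 : v' ≤ x
  · exact ⟨t, x, hXx, le_rfl, ht, h1, hx⟩
  by_cases h2 : t ≤ s
  · exact ⟨s, v', hXs, h2, hs, le_rfl, hv⟩
  have hsk : skel X t v' := by
    refine hX.skel_iff.2 ⟨⟨⟨x, by omega, hXx⟩, ?_⟩, ⟨s, by omega, hXs⟩, ?_⟩
    · rintro ⟨w, hw, hs⟩
      exact (hX.skel_iff.1 h).1.2 ⟨w, by omega, hs⟩
    · rintro ⟨w, hw, hs⟩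
      exact (hX.skel_iff.1 h').2.2 ⟨w, by omega, hs⟩
  exact absurd ⟨v', hv, hsk⟩ (hX.skel_iff.1 h).1.2

end IsPartialPerm

/-- `X` contains a decreasing chain of `m` cells in `[0,a) × [0,b)`. -/
def HasChain (X : ℕ → ℕ → Prop) (m a b : ℕ) : Prop :=
  ∃ f g : ℕ → ℕ, (∀ n < m, f n < a ∧ g n < b ∧ X (f n) (g n)) ∧
    ∀ n, n + 1 < m → f n < f (n + 1) ∧ g (n + 1) < g n

lemma hasChain_one {X : ℕ → ℕ → Prop} {a b : ℕ} :
    HasChain X 1 a b ↔ ∃ s < a, ∃ w < b, X s w := by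
  constructor
  · rintro ⟨f, g, h, -⟩
    obtain ⟨h1, h2, h3⟩ := h 0 one_pos
    exact ⟨_, h1, _, h2, h3⟩
  · rintro ⟨s, hs, w, hw, h⟩
    exact ⟨fun _ => s, fun _ => w, fun _ _ => ⟨hs, hw, h⟩, fun n hn => by omega⟩

namespace IsPartialPerm

variable {X : ℕ → ℕ → Prop}

/-- Passing to the skeleton shortens the longest decreasing chain by one. -/
lemma hasChain_skel (hX : IsPartialPerm X) {m a b : ℕ} (hm : 1 ≤ m) :
    HasChain (skel X) m a b ↔ HasChain X (m + 1) a b := by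
  constructor
  · rintro ⟨f, g, h, hfg⟩
    have key : ∀ n, ∃ s w, n < m + 1 → (s < a ∧ w < b ∧ X s w) ∧
        (∀ l, n = l + 1 → f l ≤ s ∧ w < g l) ∧ (n < m → s < f n ∧ g n ≤ w) := by
      intro n
      by_cases hn : n < m + 1
      · cases n with
        | zero =>
          obtain ⟨h1, h2, h3⟩ := h 0 (by omega)
          obtain ⟨s, hs, hXs⟩ := (hX.skel_iff.1 h3).2.1
          exact ⟨s, g 0, fun _ => ⟨⟨by omega, h2, hXs⟩, fun l hl => by omega,
            fun _ => ⟨hs, le_rfl⟩⟩⟩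
        | succ n =>
          obtain ⟨h1, h2, h3⟩ := h n (by omega)
          by_cases hn' : n + 1 < m
          · obtain ⟨h1', h2', h3'⟩ := h (n + 1) hn'
            obtain ⟨s, w, hXs, q1, q2, q3, q4⟩ :=
              hX.exists_between_skel h3 h3' (hfg n hn').1 (hfg n hn').2
            refine ⟨s, w, fun _ => ⟨⟨by omega, by omega, hXs⟩, fun l hl => ?_, fun _ => ⟨q2, q3⟩⟩⟩
            obtain rfl : n = l := by omega
            exact ⟨q1, q4⟩
          · obtain ⟨w, hw, hXw⟩ := (hX.skel_iff.1 h3).1.1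
            refine ⟨f n, w, fun _ => ⟨⟨h1, by omega, hXw⟩, fun l hl => ?_, fun h => by omega⟩⟩
            obtain rfl : n = l := by omega
            exact ⟨le_rfl, hw⟩
      · exact ⟨0, 0, fun h => absurd h hn⟩
    choose F G hFG using key
    refine ⟨F, G, fun n hn => (hFG n hn).1, fun n hn => ?_⟩
    have h1 := (hFG n (by omega)).2.2 (by omega)
    have h2 := (hFG (n + 1) hn).2.1 n rfl
    omega
  · rintro ⟨f, g, h, hfg⟩
    have key : ∀ n, ∃ s w, n < m →
        skel X s w ∧ f n < s ∧ s ≤ f (n + 1) ∧ g (n + 1) < w ∧ w ≤ g n := by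
      intro n
      by_cases hn : n < m
      · obtain ⟨s, w, hs⟩ := hX.exists_skel_between (h n (by omega)).2.2
          (h (n + 1) (by omega)).2.2 (hfg n (by omega)).1 (hfg n (by omega)).2
        exact ⟨s, w, fun _ => hs⟩
      · exact ⟨0, 0, fun h => absurd h hn⟩
    choose F G hFG using key
    refine ⟨F, G, fun n hn => ?_, fun n hn => ?_⟩
    · obtain ⟨h1, h2, h3, h4, h5⟩ := hFG n hn
      have := h n (by omega)
      have := h (n + 1) (by omega)
      exact ⟨by omega, by omega, h1⟩
    · obtain ⟨h1, h2, h3, h4, h5⟩ := hFG n (by omega)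
      obtain ⟨h1', h2', h3', h4', h5'⟩ := hFG (n + 1) hn
      omega

lemma hasChain_iterate_skel (hX : IsPartialPerm X) {m a b : ℕ} (hm : 1 ≤ m) (r : ℕ) :
    HasChain (skel^[r] X) m a b ↔ HasChain X (m + r) a b := by
  induction r generalizing m with
  | zero => rfl
  | succ r ih =>
    rw [Function.iterate_succ_apply', (hX.iterate_skel r).hasChain_skel hm, ih (by omega)]
    rw [show m + 1 + r = m + (r + 1) by ring]

lemma lev_eq_zero_iff (hX : IsPartialPerm X) {a b : ℕ} :
    lev X a b = 0 ↔ ¬ HasChain X 1 a b := by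
  rw [hasChain_one]
  constructor
  · rintro h ⟨s, hs, w, hw, hXs⟩
    have h1 := lev_succ_of_mem hXs
    have h2 : lev X (s + 1) (w + 1) ≤ lev X a (w + 1) :=
      monotone_nat_of_le_succ (f := fun a => lev X a (w + 1))
        (fun a => hX.lev_le_succ_left a (w + 1)) hs
    have h3 : lev X a (w + 1) ≤ lev X a b :=
      monotone_nat_of_le_succ (f := lev X a) (hX.lev_le_succ_right a) hw
    omega
  · intro h
    induction a with
    | zero => exact lev_zero_left X b
    | succ a ih =>
      rw [hX.lev_succ_left, ih fun ⟨s, hs, q⟩ => h ⟨s, by omega, q⟩, if_neg]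
      rintro ⟨⟨w, hw, hXw⟩, -⟩
      exact h ⟨a, by omega, w, hw, hXw⟩

lemma lev_skel_le (hX : IsPartialPerm X) (a b : ℕ) : lev (skel X) a b ≤ lev X a b := by
  induction a generalizing b with
  | zero => simp [lev_zero_left]
  | succ a iha =>
    induction b with
    | zero => simp [lev_zero_right]
    | succ b ihb =>
      have h1 := hX.lev_le_succ_left a (b + 1)
      have h2 := hX.lev_le_succ_right (a + 1) b
      by_cases hs : skel X a b
      · rw [lev_succ_of_mem hs]
        have := iha b
        have := hs.1
        omega
      · rw [lev_succ_of_not_mem hs]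
        have := iha (b + 1)
        omega

end IsPartialPerm

/-- `lam` is obtained from `mu` by adding at most one box. -/
def StepLE (mu lam : ℕ → ℕ) : Prop :=
  (∀ s, lam s = mu s ∨ lam s = mu s + 1) ∧
    ∀ s t, lam s ≠ mu s → lam t ≠ mu t → s = t

lemma eq_of_stepLE {rho mu nu : ℕ → ℕ} (h1 : StepLE rho mu) (h2 : StepLE rho nu) {s : ℕ}
    (hm : mu s ≠ rho s) (hn : nu s ≠ rho s) : mu = nu := by
  funext t
  by_cases hst : s = t
  · subst hst
    have := h1.1 s
    have := h2.1 s
    omega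
  · have q1 : mu t = rho t := by
      by_contra h; exact hst (h1.2 s t hm h)
    have q2 : nu t = rho t := by
      by_contra h; exact hst (h2.2 s t hn h)
    rw [q1, q2]

lemma eq_zero_of_stepLE {mu lam : ℕ → ℕ} (h : StepLE mu lam) (hl : lam = 0) : mu = 0 := by
  funext s
  have := h.1 s
  subst hl
  simp only [Pi.zero_apply] at this ⊢
  omega

/-- The shape at the vertex `(a,b)` of the growth diagram of `X`. -/
noncomputable def growth (X : ℕ → ℕ → Prop) (a b r : ℕ) : ℕ := lev (skel^[r] X) a b

/-- Whether a cell with three given corners is marked. -/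
def backMark (mu nu lam : ℕ → ℕ) : Prop := mu = nu ∧ lam 0 ≠ mu 0

open Classical in
/-- The lower left corner of a cell in terms of the other three corners. -/
noncomputable def back (mu nu lam : ℕ → ℕ) (s : ℕ) : ℕ :=
  if mu = nu ∧ lam (s + 1) ≠ mu (s + 1) then mu s - 1 else min (mu s) (nu s)

namespace IsPartialPerm

variable {X : ℕ → ℕ → Prop}

lemma antitone_growth (hX : IsPartialPerm X) (a b : ℕ) : Antitone (growth X a b) := by
  refine antitone_nat_of_succ_le fun r => ?_
  simp only [growth, Function.iterate_succ_apply']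
  exact (hX.iterate_skel r).lev_skel_le a b

lemma antitone_colHit (hX : IsPartialPerm X) (a b : ℕ) :
    Antitone fun r => ColHit (skel^[r] X) a b := by
  refine antitone_nat_of_succ_le fun r => ?_
  simp only [Function.iterate_succ_apply']
  exact (hX.iterate_skel r).colHit_of_skel

lemma antitone_rowHit (hX : IsPartialPerm X) (a b : ℕ) :
    Antitone fun r => RowHit (skel^[r] X) a b := by
  refine antitone_nat_of_succ_le fun r => ?_
  simp only [Function.iterate_succ_apply']
  exact (hX.iterate_skel r).rowHit_of_skel

lemma stepLE_growth_left (hX : IsPartialPerm X) (a b : ℕ) :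
    StepLE (growth X a b) (growth X (a + 1) b) := by
  have key : ∀ r, growth X (a + 1) b r ≠ growth X a b r →
      ColHit (skel^[r] X) a b ∧ ¬ ColHit (skel^[r + 1] X) a b := by
    intro r h
    rw [growth, growth, (hX.iterate_skel r).lev_succ_left, ← Function.iterate_succ_apply' skel] at h
    by_contra hc
    exact h (by rw [if_neg hc, add_zero])
  refine ⟨fun r => ?_, fun s t hs ht => ?_⟩
  · rw [growth, growth, (hX.iterate_skel r).lev_succ_left]
    split_ifs <;> simp
  · rcases lt_trichotomy s t with h | h | h
    · exact absurd (hX.antitone_colHit a b (Nat.succ_le_of_lt h) (key t ht).1) (key s hs).2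
    · exact h
    · exact absurd (hX.antitone_colHit a b (Nat.succ_le_of_lt h) (key s hs).1) (key t ht).2

lemma stepLE_growth_right (hX : IsPartialPerm X) (a b : ℕ) :
    StepLE (growth X a b) (growth X a (b + 1)) := by
  have key : ∀ r, growth X a (b + 1) r ≠ growth X a b r →
      RowHit (skel^[r] X) a b ∧ ¬ RowHit (skel^[r + 1] X) a b := by
    intro r h
    rw [growth, growth, (hX.iterate_skel r).lev_succ_right, ← Function.iterate_succ_apply' skel] at h
    by_contra hc
    exact h (by rw [if_neg hc, add_zero])
  refine ⟨fun r => ?_, fun s t hs ht => ?_⟩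
  · rw [growth, growth, (hX.iterate_skel r).lev_succ_right]
    split_ifs <;> simp
  · rcases lt_trichotomy s t with h | h | h
    · exact absurd (hX.antitone_rowHit a b (Nat.succ_le_of_lt h) (key t ht).1) (key s hs).2
    · exact h
    · exact absurd (hX.antitone_rowHit a b (Nat.succ_le_of_lt h) (key s hs).1) (key t ht).2

lemma growth_eq_of_mem (hX : IsPartialPerm X) {a b : ℕ} (h : X a b) :
    growth X (a + 1) b = growth X a b ∧ growth X a (b + 1) = growth X a b := by
  have h1 : ¬ ColHit X a b := fun ⟨b', hb', h'⟩ => by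
    have := hX.1 a b b' h h'; omega
  have h2 : ¬ RowHit X a b := fun ⟨a', ha', h'⟩ => by
    have := hX.2 a a' b h h'; omega
  constructor <;> funext r
  · rw [growth, growth, (hX.iterate_skel r).lev_succ_left, if_neg, add_zero]
    exact fun h => h1 (hX.antitone_colHit a b (Nat.zero_le r) h.1)
  · rw [growth, growth, (hX.iterate_skel r).lev_succ_right, if_neg, add_zero]
    exact fun h => h2 (hX.antitone_rowHit a b (Nat.zero_le r) h.1)

lemma growth_succ_succ {X : ℕ → ℕ → Prop} {a b r : ℕ} (h : ¬ (skel^[r] X) a b) :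
    growth X (a + 1) (b + 1) r = max (growth X (a + 1) b r) (growth X a (b + 1) r) :=
  lev_succ_of_not_mem h

lemma backMark_growth (hX : IsPartialPerm X) (a b : ℕ) :
    backMark (growth X (a + 1) b) (growth X a (b + 1)) (growth X (a + 1) (b + 1)) ↔ X a b := by
  constructor
  · rintro ⟨h1, h2⟩
    by_contra hx
    apply h2
    rw [growth_succ_succ (r := 0) hx, ← h1, max_self]
  · intro hx
    obtain ⟨h1, h2⟩ := hX.growth_eq_of_mem hx
    refine ⟨h1.trans h2.symm, ?_⟩
    rw [h1]
    have : growth X (a + 1) (b + 1) 0 = growth X a b 0 + 1 := lev_succ_of_mem hx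
    omega

lemma back_growth (hX : IsPartialPerm X) (a b : ℕ) :
    back (growth X (a + 1) b) (growth X a (b + 1)) (growth X (a + 1) (b + 1)) =
      growth X a b := by
  have e1 := hX.stepLE_growth_left a b
  have e2 := hX.stepLE_growth_right a b
  funext s
  have hs : (skel^[s + 1] X) a b ↔ growth X (a + 1) b s = growth X a b s + 1 ∧
      growth X a (b + 1) s = growth X a b s + 1 := by
    rw [Function.iterate_succ_apply']; rfl
  have f1 := e1.1 s
  have f2 := e2.1 s
  rw [back]
  split_ifs with hc
  · have : (skel^[s + 1] X) a b := by
      by_contra hx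
      apply hc.2
      rw [growth_succ_succ hx, ← hc.1, max_self]
    rw [hs] at this
    omega
  · have : ¬ (skel^[s + 1] X) a b := by
      intro hx
      have hx' := hs.1 hx
      have hmn := eq_of_stepLE e1 e2 (s := s) (by omega) (by omega)
      refine hc ⟨hmn, ?_⟩
      have h1 : growth X (a + 1) (b + 1) (s + 1) = growth X a b (s + 1) + 1 :=
        lev_succ_of_mem hx
      intro h2
      have := e1.2 s (s + 1) (by omega) (by omega)
      omega
    rw [hs] at this
    omega

end IsPartialPerm

section Back

variable {mu nu lam : ℕ → ℕ}

lemma back_of_ne (h : mu ≠ nu) (s : ℕ) : back mu nu lam s = min (mu s) (nu s) := by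
  rw [back, if_neg fun hc => h hc.1]

lemma back_self_of_ne {s : ℕ} (h : lam (s + 1) ≠ mu (s + 1)) :
    back mu mu lam s = mu s - 1 := by
  rw [back, if_pos ⟨rfl, h⟩]

lemma back_self_of_eq {s : ℕ} (h : lam (s + 1) = mu (s + 1)) :
    back mu mu lam s = mu s := by
  rw [back, if_neg fun hc => hc.2 h, min_self]

lemma back_comm : back mu nu lam = back nu mu lam := by
  by_cases h : mu = nu
  · rw [h]
  · funext s
    rw [back_of_ne h, back_of_ne (Ne.symm h), min_comm]

lemma succ_le_of_step (h : StepLE mu lam) (hl : Antitone lam) {s : ℕ}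
    (hs : lam (s + 1) ≠ mu (s + 1)) : mu (s + 1) + 1 ≤ mu s := by
  have h1 := h.1 (s + 1)
  have h2 := hl (Nat.le_succ s)
  have h3 : lam s = mu s := by
    by_contra hc
    have := h.2 _ _ hs hc
    omega
  simp only [Nat.succ_eq_add_one] at h2
  omega

lemma stepLE_back (h1 : StepLE mu lam) (h2 : StepLE nu lam) (hl : Antitone lam) :
    StepLE (back mu nu lam) mu := by
  by_cases h : mu = nu
  · subst h
    refine ⟨fun s => ?_, fun s t hs ht => ?_⟩
    · by_cases hs : lam (s + 1) = mu (s + 1)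
      · rw [back_self_of_eq hs]; simp
      · rw [back_self_of_ne hs]
        have := succ_le_of_step h1 hl hs
        omega
    · have hs' : lam (s + 1) ≠ mu (s + 1) := fun hc => hs (back_self_of_eq hc).symm
      have ht' : lam (t + 1) ≠ mu (t + 1) := fun hc => ht (back_self_of_eq hc).symm
      have := h1.2 _ _ hs' ht'
      omega
  · refine ⟨fun s => ?_, fun s t hs ht => ?_⟩
    · rw [back_of_ne h]
      have := h1.1 s
      have := h2.1 s
      omega
    · rw [back_of_ne h] at hs ht
      have := h1.1 s
      have := h1.1 t
      exact h2.2 s t (by omega) (by omega)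

lemma antitone_back (h1 : StepLE mu lam) (hl : Antitone lam) (hm : Antitone mu)
    (hn : Antitone nu) : Antitone (back mu nu lam) := by
  refine antitone_nat_of_succ_le fun s => ?_
  have q1 := hm (Nat.le_succ s)
  have q2 := hn (Nat.le_succ s)
  simp only [Nat.succ_eq_add_one] at q1 q2
  by_cases h : mu = nu
  · subst h
    have : back mu mu lam (s + 1) ≤ mu (s + 1) := by
      rw [back]; split_ifs <;> omega
    by_cases hs : lam (s + 1) = mu (s + 1)
    · rw [back_self_of_eq hs]; omega
    · rw [back_self_of_ne hs]
      have := succ_le_of_step h1 hl hs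
      omega
  · rw [back_of_ne h, back_of_ne h]
    omega

lemma back_eq_of_mark (h1 : StepLE mu lam) (h : backMark mu nu lam) :
    back mu nu lam = mu ∧ back mu nu lam = nu := by
  obtain ⟨rfl, h⟩ := h
  have : back mu mu lam = mu := by
    funext s
    apply back_self_of_eq
    by_contra hc
    have := h1.2 _ _ hc h
    omega
  exact ⟨this, this⟩

lemma ne_of_back_ne (h1 : StepLE mu lam) (h : back mu nu lam ≠ mu) : lam ≠ nu := by
  rintro rfl
  apply h
  by_cases hm : mu = lam
  · subst hm
    funext s
    exact back_self_of_eq rfl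
  · funext s
    rw [back_of_ne hm]
    have := h1.1 s
    omega

/-- The local rule in each row, recovered from the inverse local rule; `x r` says that a box is
bumped into row `r`. -/
lemma back_rule (h1 : StepLE mu lam) (h2 : StepLE nu lam) (hl : Antitone lam) {x : ℕ → Prop}
    (h0 : x 0 ↔ backMark mu nu lam)
    (hx : ∀ r, x (r + 1) ↔ mu r = back mu nu lam r + 1 ∧ nu r = back mu nu lam r + 1) (r : ℕ) :
    (x r → lam r = back mu nu lam r + 1) ∧ (¬ x r → lam r = max (mu r) (nu r)) := by
  by_cases h : mu = nu
  · subst h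
    have hxr : x r ↔ lam r ≠ mu r := by
      cases r with
      | zero => rw [h0]; simp [backMark]
      | succ r =>
        rw [hx]
        by_cases hs : lam (r + 1) = mu (r + 1)
        · rw [back_self_of_eq hs]; simp [hs]
        · rw [back_self_of_ne hs]
          have := succ_le_of_step h1 hl hs
          simp only [hs, and_self, ne_eq, not_false_eq_true, iff_true]
          omega
    rw [hxr]
    refine ⟨fun hr => ?_, fun hr => ?_⟩
    · rw [back_self_of_eq]
      · have := h1.1 r
        omega
      · by_contra hc
        have := h1.2 _ _ hc hr
        omega
    · rw [max_self]
      exact not_not.1 hr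
  · have hxr : ¬ x r := by
      cases r with
      | zero => rw [h0]; exact fun hc => h hc.1
      | succ r => rw [hx, back_of_ne h]; omega
    refine ⟨fun hc => absurd hc hxr, fun _ => ?_⟩
    have q1 := h1.1 r
    have q2 := h2.1 r
    by_contra hc
    apply h
    funext s
    by_cases hrs : r = s
    · subst hrs; omega
    · have e1 : lam s = mu s := by
        by_contra h'; exact hrs (h1.2 r s (by omega) h')
      have e2 : lam s = nu s := by
        by_contra h'; exact hrs (h2.2 r s (by omega) h')
      omega

end Back

/-- The growth diagram with prescribed boundary `y`, indexed by the distance `n` to the boundary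
and the first coordinate. -/
noncomputable def backGrid (y : ℕ → ℕ → ℕ) : ℕ → ℕ → ℕ → ℕ
  | 0, a => y (2 * a - 1)
  | 1, a => y (2 * a)
  | n + 2, a => back (backGrid y (n + 1) (a + 1)) (backGrid y (n + 1) a) (backGrid y n (a + 1))

/-- A `ℬ`-walk of integer partitions which starts at the empty partition and is constantly empty
from time `2 * N` on. -/
structure IsShapeWalk (N : ℕ) (y : ℕ → ℕ → ℕ) : Prop where
  anti : ∀ t, Antitone (y t)
  step_left : ∀ a, StepLE (y (2 * a)) (y (2 * a + 1))
  step_right : ∀ a, StepLE (y (2 * a)) (y (2 * a - 1))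
  zero : y 0 = 0
  eq_zero : ∀ t, 2 * N ≤ t → y t = 0

/-- The filling with boundary walk `y`. -/
def backFill (N : ℕ) (y : ℕ → ℕ → ℕ) (a b : ℕ) : Prop :=
  ∃ n, a + b + n + 1 = N ∧
    backMark (backGrid y (n + 1) (a + 1)) (backGrid y (n + 1) a) (backGrid y n (a + 1))

namespace IsShapeWalk

variable {N : ℕ} {y : ℕ → ℕ → ℕ}

lemma backGrid_spec (hy : IsShapeWalk N y) (n : ℕ) :
    (∀ a, Antitone (backGrid y n a)) ∧ (∀ a, Antitone (backGrid y (n + 1) a)) ∧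
    ∀ a, StepLE (backGrid y (n + 1) a) (backGrid y n a) ∧
      StepLE (backGrid y (n + 1) a) (backGrid y n (a + 1)) := by
  induction n with
  | zero =>
    refine ⟨fun a => hy.anti _, fun a => hy.anti _, fun a => ?_⟩
    simp only [backGrid]
    exact ⟨hy.step_right a, hy.step_left a⟩
  | succ n ih =>
    obtain ⟨h1, h2, h3⟩ := ih
    refine ⟨h2, fun a => ?_, fun a => ?_⟩
    · rw [backGrid]
      exact antitone_back (h3 (a + 1)).1 (h1 _) (h2 _) (h2 _)
    · rw [backGrid]
      refine ⟨?_, stepLE_back (h3 (a + 1)).1 (h3 a).2 (h1 _)⟩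
      rw [back_comm]
      exact stepLE_back (h3 a).2 (h3 (a + 1)).1 (h1 _)

lemma anti_backGrid (hy : IsShapeWalk N y) (n a : ℕ) : Antitone (backGrid y n a) :=
  (hy.backGrid_spec n).1 a

lemma step_left_backGrid (hy : IsShapeWalk N y) (n a : ℕ) :
    StepLE (backGrid y (n + 1) a) (backGrid y n (a + 1)) :=
  ((hy.backGrid_spec n).2.2 a).2

lemma step_right_backGrid (hy : IsShapeWalk N y) (n a : ℕ) :
    StepLE (backGrid y (n + 1) a) (backGrid y n a) :=
  ((hy.backGrid_spec n).2.2 a).1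

lemma backGrid_zero_right (hy : IsShapeWalk N y) (n : ℕ) : backGrid y n 0 = 0 := by
  induction n with
  | zero => exact hy.zero
  | succ n ih => exact eq_zero_of_stepLE (hy.step_right_backGrid n 0) ih

lemma backGrid_diag (hy : IsShapeWalk N y) (n a : ℕ) (h : a + n = N + 1) :
    backGrid y n a = 0 := by
  induction n generalizing a with
  | zero => exact hy.eq_zero _ (by omega)
  | succ n ih => exact eq_zero_of_stepLE (hy.step_left_backGrid n a) (ih (a + 1) (by omega))

lemma isPartialPerm_backFill (hy : IsShapeWalk N y) : IsPartialPerm (backFill N y) := by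
  have hcol : ∀ a b b', b < b' → backFill N y a b → ¬ backFill N y a b' := by
    rintro a b b' hb ⟨n, hn, hm⟩ ⟨n', hn', hm'⟩
    have key : ∀ d m, m + d = n → backGrid y m (a + 1) ≠ backGrid y (m + 1) a := by
      intro d
      induction d with
      | zero =>
        rintro m hm0
        obtain rfl : m = n := by omega
        intro hc
        exact hm.2 (by rw [hc, hm.1])
      | succ d ih =>
        intro m hm0
        have := ih (m + 1) (by omega)
        apply ne_of_back_ne (hy.step_right_backGrid m (a + 1))
        exact this.symm
    have hb' := (back_eq_of_mark (hy.step_right_backGrid n' (a + 1)) hm').1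
    exact key (n - (n' + 1)) (n' + 1) (by omega) hb'.symm
  have hrow : ∀ a a' b, a < a' → backFill N y a b → ¬ backFill N y a' b := by
    rintro a a' b ha ⟨n, hn, hm⟩ ⟨n', hn', hm'⟩
    have key : ∀ d m c, m + d = n → c = a + d →
        backGrid y m (c + 1) ≠ backGrid y (m + 1) (c + 1) := by
      intro d
      induction d with
      | zero =>
        rintro m c hm0 rfl
        obtain rfl : m = n := by omega
        intro hc
        exact hm.2 (congrFun hc 0)
      | succ d ih =>
        intro m c hm0 hc
        have := ih (m + 1) (a + d) (by omega) rfl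
        rw [show a + d + 1 = c by omega] at this
        apply ne_of_back_ne (nu := backGrid y (m + 1) (c + 1)) (hy.step_left_backGrid m c)
        rw [back_comm]
        exact this.symm
    have hb' := (back_eq_of_mark (hy.step_right_backGrid n' (a' + 1)) hm').2
    obtain ⟨c, rfl⟩ : ∃ c, a' = c + 1 := ⟨a' - 1, by omega⟩
    exact key (n - (n' + 1)) (n' + 1) c (by omega) (by omega) hb'.symm
  refine ⟨fun a b b' h h' => ?_, fun a a' b h h' => ?_⟩
  · rcases lt_trichotomy b b' with hb | hb | hb
    · exact absurd h' (hcol _ _ _ hb h)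
    · exact hb
    · exact absurd h (hcol _ _ _ hb h')
  · rcases lt_trichotomy a a' with hb | hb | hb
    · exact absurd h' (hrow _ _ _ hb h)
    · exact hb
    · exact absurd h (hrow _ _ _ hb h')

/-- The growth diagram of the filling recovered from `y` is the one constructed backwards. -/
lemma growth_backFill (hy : IsShapeWalk N y) (a b n : ℕ) (h : a + b + n = N + 1) :
    growth (backFill N y) a b = backGrid y n a := by
  funext r
  induction r using Nat.strong_induction_on generalizing a b n with
  | _ r ihr =>
    induction a generalizing b n with
    | zero => rw [growth, lev_zero_left, hy.backGrid_zero_right]; rfl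
    | succ a iha =>
      induction b generalizing n with
      | zero => rw [growth, lev_zero_right, hy.backGrid_diag n _ (by omega)]; rfl
      | succ b ihb =>
        have e1 := ihb (n + 1) (by omega)
        have e2 := iha (b + 1) (n + 1) (by omega)
        have e3 := iha b (n + 2) (by omega)
        have rule := back_rule (x := fun r =>
            r = 0 ∧ backFill N y a b ∨ ∃ s, r = s + 1 ∧
              backGrid y (n + 1) (a + 1) s = backGrid y (n + 2) a s + 1 ∧
              backGrid y (n + 1) a s = backGrid y (n + 2) a s + 1)
          (hy.step_right_backGrid n (a + 1)) (hy.step_left_backGrid n a) (hy.anti_backGrid n _)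
          (by
            simp only [true_and, backFill]
            constructor
            · rintro (⟨n', hn', hm⟩ | ⟨s, hs, -⟩)
              · obtain rfl : n' = n := by omega
                exact hm
              · omega
            · intro hm
              exact Or.inl ⟨n, by omega, hm⟩)
          (by
            intro s
            rw [← backGrid]
            simp) r
        have hx : (skel^[r] (backFill N y)) a b ↔ r = 0 ∧ backFill N y a b ∨ ∃ s, r = s + 1 ∧
              backGrid y (n + 1) (a + 1) s = backGrid y (n + 2) a s + 1 ∧
              backGrid y (n + 1) a s = backGrid y (n + 2) a s + 1 := by
          cases r with
          | zero => simp
          | succ r =>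
            rw [Function.iterate_succ_apply']
            have q1 := ihr r (by omega) (a + 1) b (n + 1) (by omega)
            have q2 := ihr r (by omega) a (b + 1) (n + 1) (by omega)
            have q3 := ihr r (by omega) a b (n + 2) (by omega)
            rw [growth] at q1 q2 q3
            simp [skel, q1, q2, q3]
        rw [← backGrid] at rule
        by_cases hc : (skel^[r] (backFill N y)) a b
        · rw [rule.1 (hx.1 hc), ← e3]
          exact lev_succ_of_mem hc
        · rw [rule.2 fun h => hc (hx.2 h), ← e1, ← e2]
          exact IsPartialPerm.growth_succ_succ hc

end IsShapeWalk

/-- The shapes along the boundary of the staircase. -/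
noncomputable def boundary (N : ℕ) (X : ℕ → ℕ → Prop) (t : ℕ) : ℕ → ℕ :=
  growth X ((t + 1) / 2) (N - t / 2)

/-- A filling of the staircase is determined by the shapes along the boundary. -/
lemma eq_of_boundary_eq {N : ℕ} {X X' : ℕ → ℕ → Prop} (hX : IsPartialPerm X)
    (hX' : IsPartialPerm X') (hs : ∀ a b, X a b → a + b < N) (hs' : ∀ a b, X' a b → a + b < N)
    (h : ∀ t ≤ 2 * N, boundary N X t = boundary N X' t) : X = X' := by
  have hzl : ∀ {Y : ℕ → ℕ → Prop} {b}, growth Y 0 b = 0 := by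
    intro Y b; funext r; exact lev_zero_left _ _
  have hzr : ∀ {Y : ℕ → ℕ → Prop} {a}, growth Y a 0 = 0 := by
    intro Y b; funext r; exact lev_zero_right _ _
  have h0 : ∀ a b, a + b = N + 1 → growth X a b = growth X' a b := by
    intro a b hab
    cases a with
    | zero => rw [hzl, hzl]
    | succ a =>
      cases b with
      | zero => rw [hzr, hzr]
      | succ b =>
        have := h (2 * a + 1) (by omega)
        rw [boundary, boundary, show (2 * a + 1 + 1) / 2 = a + 1 by omega,
          show N - (2 * a + 1) / 2 = b + 1 by omega] at this
        exact this
  have h1 : ∀ a b, a + b = N → growth X a b = growth X' a b := by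
    intro a b hab
    have := h (2 * a) (by omega)
    rw [boundary, boundary, show (2 * a + 1) / 2 = a by omega,
      show N - (2 * a) / 2 = b by omega] at this
    exact this
  have hG : ∀ n a b, a + b + n = N + 1 → growth X a b = growth X' a b := by
    intro n
    induction n using Nat.strong_induction_on with
    | _ n ih =>
      intro a b hab
      match n with
      | 0 => exact h0 a b hab
      | 1 => exact h1 a b (by omega)
      | n + 2 =>
        rw [← hX.back_growth, ← hX'.back_growth, ih (n + 1) (by omega) (a + 1) b (by omega),
          ih (n + 1) (by omega) a (b + 1) (by omega),
          ih n (by omega) (a + 1) (b + 1) (by omega)]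
  have key : ∀ a b, a + b < N → (X a b ↔ X' a b) := by
    intro a b hab
    rw [← hX.backMark_growth, ← hX'.backMark_growth,
      hG (N - (a + b)) (a + 1) b (by omega), hG (N - (a + b)) a (b + 1) (by omega),
      hG (N - (a + b) - 1) (a + 1) (b + 1) (by omega)]
  funext a b
  exact propext ⟨fun hx => (key a b (hs a b hx)).1 hx, fun hx => (key a b (hs' a b hx)).2 hx⟩

/-- The shape at `(a,b)` has at most `r` rows iff `X` has no decreasing chain of length `r + 1`
in `[0,a) × [0,b)`. -/
lemma growth_eq_zero_iff {X : ℕ → ℕ → Prop} (hX : IsPartialPerm X) {a b r : ℕ} :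
    growth X a b r = 0 ↔ ¬ HasChain X (r + 1) a b := by
  rw [growth, (hX.iterate_skel r).lev_eq_zero_iff, hX.hasChain_iterate_skel le_rfl, add_comm]

section Points

variable {k : ℕ}

/-- The point of `ℤ^(k-1)` encoding a partition with at most `k - 1` rows. -/
def toPt (k : ℕ) (mu : ℕ → ℕ) : Pt k := fun i => mu i + delta k i

/-- The partition encoded by a point of `W_{k-1}`. -/
def ofPt (v : Pt k) (s : ℕ) : ℕ :=
  if h : s < k - 1 then (v ⟨s, h⟩ - delta k ⟨s, h⟩).toNat else 0

lemma inW_toPt {mu : ℕ → ℕ} (h : Antitone mu) : inW (toPt k mu) := by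
  refine ⟨fun i j hij => ?_, fun i => ?_⟩
  · have h1 : (i : ℕ) < j := hij
    have := h h1.le
    simp only [toPt, delta]
    omega
  · have := i.2
    simp only [toPt, delta]
    omega

lemma delta_le_of_inW {v : Pt k} (h : inW v) (i : Fin (k - 1)) : delta k i ≤ v i := by
  have key : ∀ n : ℕ, ∀ i : Fin (k - 1), (i : ℕ) + n + 2 = k → (n : ℤ) ≤ v i := by
    intro n
    induction n with
    | zero => intro i _; exact h.2 i
    | succ n ih =>
      intro i hi
      have h1 := ih ⟨i + 1, by omega⟩ (by simp only; omega)
      have h2 : v ⟨i + 1, by omega⟩ < v i := h.1 (by rw [Fin.lt_def]; simp)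
      push_cast
      omega
  have hi := i.2
  have := key (k - 2 - i) i (by omega)
  simp only [delta]
  omega

lemma ofPt_apply {v : Pt k} (h : inW v) (i : Fin (k - 1)) :
    (ofPt v i : ℤ) = v i - delta k i := by
  have := delta_le_of_inW h i
  rw [ofPt, dif_pos i.2]
  simp only [Fin.eta]
  omega

lemma ofPt_eq_zero (v : Pt k) {s : ℕ} (h : k - 1 ≤ s) : ofPt v s = 0 := by
  rw [ofPt, dif_neg (by omega)]

lemma toPt_ofPt {v : Pt k} (h : inW v) : toPt k (ofPt v) = v := by
  funext i
  rw [toPt, ofPt_apply h]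
  ring

lemma toPt_inj {mu nu : ℕ → ℕ} (hm : ∀ s, k - 1 ≤ s → mu s = 0)
    (hn : ∀ s, k - 1 ≤ s → nu s = 0) (h : toPt k mu = toPt k nu) : mu = nu := by
  funext s
  by_cases hs : s < k - 1
  · have := congrFun h ⟨s, hs⟩
    simp only [toPt] at this
    omega
  · rw [hm s (by omega), hn s (by omega)]

lemma toPt_zero : toPt k 0 = delta k := by
  funext i; simp [toPt]

lemma ofPt_delta : ofPt (delta k) = 0 := by
  funext s
  rw [ofPt]
  split_ifs <;> simp

lemma antitone_ofPt {v : Pt k} (h : inW v) : Antitone (ofPt v) := by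
  refine antitone_nat_of_succ_le fun s => ?_
  by_cases hs : s + 1 < k - 1
  · have h1 := ofPt_apply h ⟨s, by omega⟩
    have h2 := ofPt_apply h ⟨s + 1, hs⟩
    have h3 : v ⟨s + 1, hs⟩ < v ⟨s, by omega⟩ := h.1 (by rw [Fin.lt_def]; simp)
    simp only [delta] at h1 h2
    push_cast at h2
    omega
  · rw [ofPt_eq_zero v (by omega)]
    exact Nat.zero_le _

lemma plusStep_iff (hk : 1 ≤ k) {mu lam : ℕ → ℕ} (hm : ∀ s, k - 1 ≤ s → mu s = 0)
    (hl : ∀ s, k - 1 ≤ s → lam s = 0) :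
    plusStep (toPt k lam - toPt k mu) ↔ StepLE mu lam := by
  constructor
  · rintro ⟨i, hi⟩
    have key : ∀ s, (lam s : ℤ) = mu s + if s + 1 = (i : ℕ) then 1 else 0 := by
      intro s
      by_cases hs : s < k - 1
      · have := congrFun hi ⟨s, hs⟩
        simp only [toPt, eVec, Pi.sub_apply] at this
        omega
      · have := i.2
        rw [hm s (by omega), hl s (by omega), if_neg (by omega)]
        simp
    refine ⟨fun s => ?_, fun s t hs ht => ?_⟩
    · have := key s
      split_ifs at this <;> omega
    · have h1 := key s
      have h2 := key t
      split_ifs at h1 h2 <;> omega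
  · intro h
    by_cases hs : ∃ s, lam s ≠ mu s
    · obtain ⟨s, hs⟩ := hs
      have hsk : s < k - 1 := by
        by_contra hc
        exact hs (by rw [hm s (by omega), hl s (by omega)])
      refine ⟨⟨s + 1, by omega⟩, funext fun j => ?_⟩
      have h1 := h.1 j
      have h2 := h.2 s j hs
      have h3 := h.1 s
      simp only [toPt, eVec, Pi.sub_apply, add_left_inj]
      split_ifs with hj
      · rw [← hj] at hs
        omega
      · have : lam j = mu j := by
          by_contra hc; exact hj (h2 hc).symm
        rw [this]; ring
    · push Not at hs
      refine ⟨⟨0, hk⟩, funext fun j => ?_⟩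
      simp [toPt, eVec, hs]

lemma minusStep_iff_plusStep_neg {d : Pt k} : minusStep d ↔ plusStep (-d) := by
  simp only [minusStep, plusStep, neg_eq_iff_eq_neg]

end Points

section Braids

variable {N : ℕ}

/-- The filling of the staircase whose cells are the arcs of `A`. -/
def fill (A : Finset (Fin N × Fin N)) (a b : ℕ) : Prop :=
  ∃ p ∈ A, (p.1 : ℕ) = a ∧ (p.2 : ℕ) + b + 1 = N

lemma mem_iff_fill {A : Finset (Fin N × Fin N)} (p : Fin N × Fin N) :
    p ∈ A ↔ fill A p.1 (N - 1 - p.2) := by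
  have h2 := p.2.2
  constructor
  · intro h
    exact ⟨p, h, rfl, by omega⟩
  · rintro ⟨q, hq, hq1, hq2⟩
    obtain rfl : q = p := Prod.ext (Fin.ext hq1) (Fin.ext (by omega))
    exact hq

lemma fill_injective : Function.Injective (fill (N := N)) := by
  intro A A' h
  ext p
  rw [mem_iff_fill, mem_iff_fill, h]

lemma isPartialPerm_fill {A : Finset (Fin N × Fin N)} (hA : IsBraid A) :
    IsPartialPerm (fill A) := by
  constructor
  · rintro a b b' ⟨p, hp, rfl, hb⟩ ⟨q, hq, hpq, hb'⟩
    have := hA.2.1 p hp q hq (Fin.ext hpq.symm)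
    subst this
    omega
  · rintro a a' b ⟨p, hp, rfl, hb⟩ ⟨q, hq, rfl, hb'⟩
    rw [hA.2.2 p hp q hq (Fin.ext (by omega))]

lemma add_lt_of_fill {A : Finset (Fin N × Fin N)} (hA : IsBraid A) {a b : ℕ}
    (h : fill A a b) : a + b < N := by
  obtain ⟨p, hp, rfl, hb⟩ := h
  have : (p.1 : ℕ) ≤ p.2 := hA.1 p hp
  omega

lemma exists_braid {X : ℕ → ℕ → Prop} (hX : IsPartialPerm X) (hs : ∀ a b, X a b → a + b < N) :
    ∃ A : Finset (Fin N × Fin N), IsBraid A ∧ fill A = X := by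
  classical
  have hmem : ∀ p, p ∈ (Finset.univ.filter fun p : Fin N × Fin N => X p.1 (N - 1 - p.2)) ↔
    X p.1 (N - 1 - p.2) := by simp
  refine ⟨Finset.univ.filter fun p => X p.1 (N - 1 - p.2), ⟨?_, ?_, ?_⟩, ?_⟩
  · intro p hp
    have := hs _ _ ((hmem p).1 hp)
    rw [Fin.le_def]
    omega
  · intro p hp q hq hpq
    rw [hmem] at hp hq
    rw [← hpq] at hq
    have := hX.1 _ _ _ hp hq
    exact Prod.ext hpq (Fin.ext (by omega))
  · intro p hp q hq hpq
    rw [hmem] at hp hq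
    rw [← hpq] at hq
    exact Prod.ext (Fin.ext (hX.2 _ _ _ hp hq)) hpq
  · funext a b
    refine propext ⟨?_, fun h => ?_⟩
    · rintro ⟨p, hp, rfl, hb⟩
      rw [hmem] at hp
      rwa [show N - 1 - (p.2 : ℕ) = b by omega] at hp
    · have := hs a b h
      refine ⟨(⟨a, by omega⟩, ⟨N - 1 - b, by omega⟩), ?_, rfl, by simp only; omega⟩
      rw [hmem]
      simp only
      rwa [show N - 1 - (N - 1 - b) = b by omega]

lemma braidHasKCrossing_iff {A : Finset (Fin N × Fin N)} {k : ℕ} :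
    BraidHasKCrossing (k + 1) A ↔ ∃ a b, a + b ≤ N + 1 ∧ HasChain (fill A) (k + 1) a b := by
  constructor
  · rintro ⟨ii, jj, hmem, hi, hj, hij⟩
    let c : ℕ → Fin (k + 1) := fun n => ⟨min n k, by omega⟩
    have hc : ∀ n, n + 1 < k + 1 → c n < c (n + 1) := by
      intro n hn
      simp only [c, Fin.lt_def]
      omega
    have hlast := hij (Fin.last k) 0
    refine ⟨ii (Fin.last k) + 1, N - jj 0, ?_, fun n => ii (c n), fun n => N - 1 - jj (c n),
      fun n hn => ⟨?_, ?_, ?_⟩, fun n hn => ⟨hi (hc n hn), ?_⟩⟩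
    · rw [Fin.le_def] at hlast
      omega
    · have := hi.monotone (Fin.le_last (c n))
      rw [Fin.le_def] at this
      simp only
      omega
    · have := hj.monotone (Fin.zero_le (c n))
      rw [Fin.le_def] at this
      have := (jj (c n)).2
      simp only
      omega
    · exact (mem_iff_fill _).1 (hmem (c n))
    · have := hj (hc n hn)
      rw [Fin.lt_def] at this
      have := (jj (c (n + 1))).2
      simp only
      omega
  · rintro ⟨a, b, hab, f, g, h, hfg⟩
    have : Nonempty (Fin N × Fin N) := ⟨(h 0 (Nat.succ_pos k)).2.2.choose⟩
    choose! p hp using fun n (hn : n < k + 1) => (h n hn).2.2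
    refine ⟨fun m => (p m).1, fun m => (p m).2, fun m => (hp m m.2).1,
      Fin.strictMono_iff_lt_succ.2 fun m => ?_, Fin.strictMono_iff_lt_succ.2 fun m => ?_,
      fun m m' => ?_⟩
    · have h1 := hp m (by omega)
      have h2 := hp (m + 1) (by omega)
      have h3 := hfg m (by omega)
      rw [Fin.lt_def]
      simp only [Fin.val_castSucc, Fin.val_succ]
      omega
    · have h1 := hp m (by omega)
      have h2 := hp (m + 1) (by omega)
      have h3 := hfg m (by omega)
      rw [Fin.lt_def]
      simp only [Fin.val_castSucc, Fin.val_succ]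
      omega
    · have h1 := hp m m.2
      have h2 := hp m' m'.2
      have h3 := h m m.2
      have h4 := h m' m'.2
      rw [Fin.le_def]
      simp only
      omega

lemma not_braidHasKCrossing_iff {A : Finset (Fin N × Fin N)} (hA : IsBraid A) {k : ℕ}
    (hk : 1 ≤ k) :
    ¬ BraidHasKCrossing k A ↔ ∀ a b, a + b ≤ N + 1 → growth (fill A) a b (k - 1) = 0 := by
  obtain ⟨k, rfl⟩ : ∃ l, k = l + 1 := ⟨k - 1, by omega⟩
  simp only [braidHasKCrossing_iff, growth_eq_zero_iff (isPartialPerm_fill hA), not_exists,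
    not_and, Nat.add_sub_cancel]

end Braids

lemma isShapeWalk_ofPt {k N : ℕ} (hk : 1 ≤ k) {v : Fin (2 * N + 1) → Pt k}
    (hv : IsBWalk (inW (k := k)) (2 * N) v) (hlast : v (Fin.last (2 * N)) = delta k) :
    IsShapeWalk N fun t => if h : t < 2 * N + 1 then ofPt (v ⟨t, h⟩) else 0 := by
  obtain ⟨h0, hW, hstep⟩ := hv
  have hzero : ∀ t, 2 * N ≤ t →
      (if h : t < 2 * N + 1 then ofPt (v ⟨t, h⟩) else 0) = (0 : ℕ → ℕ) := by
    intro t ht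
    split_ifs with h
    · obtain rfl : t = 2 * N := by omega
      rw [← ofPt_delta (k := k), ← hlast]
      rfl
    · rfl
  have hrefl : ∀ mu : ℕ → ℕ, StepLE mu mu := fun mu =>
    ⟨fun _ => Or.inl rfl, fun s t h => absurd rfl h⟩
  refine ⟨fun t => ?_, fun a => ?_, fun a => ?_, ?_, hzero⟩
  · split_ifs
    · exact antitone_ofPt (hW _)
    · exact fun _ _ _ => le_rfl
  · by_cases ha : 2 * a + 1 < 2 * N + 1
    · rw [dif_pos ha, dif_pos (by omega), ← plusStep_iff hk (fun s => ofPt_eq_zero _)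
        (fun s => ofPt_eq_zero _), toPt_ofPt (hW _), toPt_ofPt (hW _)]
      exact (hstep (2 * a) ha).1 ⟨a, rfl⟩
    · rw [hzero _ (by omega), hzero _ (by omega)]
      exact hrefl 0
  · by_cases ha : a = 0
    · subst ha
      exact hrefl _
    by_cases ha' : 2 * a < 2 * N + 1
    · rw [dif_pos ha', dif_pos (by omega), ← plusStep_iff hk (fun s => ofPt_eq_zero _)
        (fun s => ofPt_eq_zero _), toPt_ofPt (hW _), toPt_ofPt (hW _)]
      obtain ⟨c, rfl⟩ : ∃ c, a = c + 1 := ⟨a - 1, by omega⟩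
      have := (hstep (2 * c + 1) ha').2 ⟨c + 1, by ring⟩
      rw [minusStep_iff_plusStep_neg, neg_sub] at this
      exact this
    · rw [hzero _ (by omega), hzero _ (by omega)]
      exact hrefl 0
  · rw [dif_pos (by omega), h0, ofPt_delta]

lemma boundary_eq_zero {k N : ℕ} (hk : 1 ≤ k) {A : Finset (Fin N × Fin N)} (hA : IsBraid A)
    (hc : ¬ BraidHasKCrossing k A) {t : ℕ} (ht : t ≤ 2 * N) {s : ℕ} (hs : k - 1 ≤ s) :
    boundary N (fill A) t s = 0 := by
  have h1 := (not_braidHasKCrossing_iff hA hk).1 hc ((t + 1) / 2) (N - t / 2) (by omega)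
  have h2 := (isPartialPerm_fill hA).antitone_growth ((t + 1) / 2) (N - t / 2) hs
  rw [boundary]
  omega

lemma isBWalk_boundary {k N : ℕ} (hk : 1 ≤ k) {A : Finset (Fin N × Fin N)} (hA : IsBraid A)
    (hc : ¬ BraidHasKCrossing k A) :
    IsBWalk (inW (k := k)) (2 * N) (fun t => toPt k (boundary N (fill A) t)) ∧
      toPt k (boundary N (fill A) (Fin.last (2 * N))) = delta k := by
  have hX := isPartialPerm_fill hA
  refine ⟨⟨?_, fun t => inW_toPt (hX.antitone_growth _ _), fun t ht => ⟨?_, ?_⟩⟩, ?_⟩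
  · have h0 : boundary N (fill A) 0 = 0 := funext fun r => lev_zero_left _ _
    simp only [h0, toPt_zero]
  · rintro ⟨c, hc'⟩
    obtain rfl : t = 2 * c := by omega
    simp only
    rw [plusStep_iff hk (fun s => boundary_eq_zero hk hA hc (by omega))
      (fun s => boundary_eq_zero hk hA hc (by omega)), boundary, boundary,
      show (2 * c + 1 + 1) / 2 = c + 1 by omega, show (2 * c + 1) / 2 = c by omega,
      show 2 * c / 2 = c by omega]
    exact hX.stepLE_growth_left _ _
  · rintro ⟨c, hc'⟩
    obtain ⟨c, rfl⟩ : ∃ d, c = d + 1 := ⟨c - 1, by omega⟩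
    obtain rfl : t = 2 * c + 1 := by omega
    simp only
    rw [minusStep_iff_plusStep_neg, neg_sub,
      plusStep_iff hk (fun s => boundary_eq_zero hk hA hc (by omega))
      (fun s => boundary_eq_zero hk hA hc (by omega)), boundary, boundary,
      show (2 * c + 1 + 1 + 1) / 2 = c + 1 by omega, show (2 * c + 1 + 1) / 2 = c + 1 by omega,
      show (2 * c + 1) / 2 = c by omega, show N - c = N - (c + 1) + 1 by omega]
    exact hX.stepLE_growth_right _ _
  · rw [← toPt_zero]
    congr 1
    funext r
    rw [boundary, Fin.val_last, show N - 2 * N / 2 = 0 by omega]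
    exact lev_zero_right _ _

/-- For `k ≥ 3` and `N ≥ 1`, the number of `k`-noncrossing braids
over `[N]` equals the number of `ℬ_{W_{k-1}}`-walks of length `2N` from `δ` to `δ`. -/
theorem braids_eq_BWalks (k N : ℕ) (hk : 3 ≤ k) (hN : 1 ≤ N) :
    Nat.card {A : Finset (Fin N × Fin N) // IsBraid A ∧ ¬ BraidHasKCrossing k A} =
    Nat.card {v : Fin (2 * N + 1) → Pt k //
        IsBWalk (inW (k := k)) (2 * N) v ∧ v (Fin.last (2 * N)) = delta k} := by
  have hk1 : 1 ≤ k := by omega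
  refine Nat.card_eq_of_bijective
    (fun A => ⟨fun t => toPt k (boundary N (fill A.1) t), isBWalk_boundary hk1 A.2.1 A.2.2⟩)
    ⟨?_, ?_⟩
  · rintro ⟨A, hA, hc⟩ ⟨A', hA', hc'⟩ h
    simp only [Subtype.mk.injEq] at h
    rw [Subtype.mk.injEq]
    refine fill_injective (eq_of_boundary_eq (isPartialPerm_fill hA) (isPartialPerm_fill hA')
      (fun a b => add_lt_of_fill hA) (fun a b => add_lt_of_fill hA') fun t ht => ?_)
    exact toPt_inj (fun s => boundary_eq_zero hk1 hA hc ht)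
      (fun s => boundary_eq_zero hk1 hA' hc' ht) (congrFun h ⟨t, by omega⟩)
  · rintro ⟨v, hv, hlast⟩
    have hy := isShapeWalk_ofPt hk1 hv hlast
    set y : ℕ → ℕ → ℕ := fun t => if h : t < 2 * N + 1 then ofPt (v ⟨t, h⟩) else 0 with hydef
    have hyk : ∀ t, y t (k - 1) = 0 := by
      intro t
      simp only [hydef]
      split_ifs
      · exact ofPt_eq_zero _ le_rfl
      · rfl
    obtain ⟨A, hA, hfill⟩ := exists_braid (N := N) hy.isPartialPerm_backFill (by
      rintro a b ⟨n, hn, -⟩; omega)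
    have hgrid : ∀ n a, backGrid y n a (k - 1) = 0 := by
      intro n
      induction n with
      | zero => intro a; exact hyk _
      | succ n ih =>
        intro a
        have := (hy.step_right_backGrid n a).1 (k - 1)
        rw [ih] at this
        omega
    have hc : ¬ BraidHasKCrossing k A := by
      rw [not_braidHasKCrossing_iff hA hk1, hfill]
      intro a b hab
      rw [hy.growth_backFill a b (N + 1 - (a + b)) (by omega), hgrid]
    refine ⟨⟨A, hA, hc⟩, Subtype.ext (funext fun t => ?_)⟩
    simp only [hfill]
    rw [← toPt_ofPt (hv.2.1 t)]
    congr 1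
    have hyt : y t = ofPt (v t) := dif_pos t.2
    rw [← hyt, boundary]
    obtain ⟨c, hc' | hc'⟩ := Nat.even_or_odd' (t : ℕ)
    · rw [hy.growth_backFill _ _ 1 (by omega), backGrid, hc']
      congr 1
      omega
    · rw [hy.growth_backFill _ _ 0 (by omega), backGrid, hc']
      congr 1
      omega
end
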